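/- arXiv:2311.13506 — 13 statements merged into one kernel-verified Lean document; each statement's English description precedes it below -/
import Mathlib

section
/- Let n ≥ 1, let W = (w_{ij}) be a real n × n matrix with constant row sums v (i.e., Σ_j w_{ij} = v for all i), and let g, h be continuously differentiable with g₀ = ∂g/∂x(0,0), h₁ = ∂h/∂x₁(0,0,0), h₂ = ∂h/∂x₂(0,0,0). Let F be the input-additive admissible system built from W, g, h, and let J be the Jacobian matrix of x ↦ F(x, 0) at x = 0. If μ₁, …, μ_n ∈ ℂ are the eigenvalues of W counted with algebraic multiplicity (the complex roots of its characteristic polynomial), then the characteristic polynomial of J equals ∏_{j=1}^n (X − (g₀ + v·h₁ + h₂·μ_j)); in particular, the eigenvalues of J, with algebraic multiplicity, are g₀ + v·h₁ + h₂·μ_j for j = 1, …, n. -/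
open Matrix Polynomial

/-- The input-additive admissible coupled cell system associated with a weighted
adjacency matrix `W`, internal dynamics `g` and coupling function `h`:
`F_i(x, λ) = g(x_i, λ) + ∑_j w_{ij} h(x_i, x_j, λ)`. -/
def admissF {ι : Type*} [Fintype ι] (W : Matrix ι ι ℝ) (g : ℝ → ℝ → ℝ)
    (h : ℝ → ℝ → ℝ → ℝ) (x : ι → ℝ) (lam : ℝ) (i : ι) : ℝ :=
  g (x i) lam + ∑ j, W i j * h (x i) (x j) lam

/-- The characteristic polynomial of `a • 1 + b • M` when that of `M` splits. -/
theorem charpoly_smul_one_add_smul {K ι : Type*} [Field K] [Infinite K] [Fintype ι]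
    [DecidableEq ι] (M : Matrix ι ι K) (μ : ι → K) (hμ : M.charpoly = ∏ j, (X - C (μ j)))
    (a b : K) :
    (a • (1 : Matrix ι ι K) + b • M).charpoly = ∏ j, (X - C (a + b * μ j)) := by
  refine Polynomial.funext fun t => ?_
  have hM : ∀ s : K, (s • (1 : Matrix ι ι K) - M).det = ∏ j, (s - μ j) := by
    intro s
    have := congrArg (Polynomial.eval s) hμ
    rw [Matrix.eval_charpoly, Polynomial.eval_prod] at this
    simpa [← Matrix.smul_one_eq_diagonal] using this
  rw [Matrix.eval_charpoly, Polynomial.eval_prod]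
  simp only [eval_sub, eval_X, eval_C, Matrix.scalar_apply, ← Matrix.smul_one_eq_diagonal]
  rcases eq_or_ne b 0 with rfl | hb
  · simp [← sub_smul]
  · have key : t • (1 : Matrix ι ι K) - (a • 1 + b • M) = b • (((t - a) / b) • 1 - M) := by
      rw [smul_sub, smul_smul, mul_div_cancel₀ _ hb, sub_smul]
      abel
    rw [key, Matrix.det_smul, hM, ← Finset.card_univ, ← Finset.prod_const,
      ← Finset.prod_mul_distrib]
    refine Finset.prod_congr rfl fun j _ => ?_
    field_simp
    ring

/-- The derivative at the origin of a coupling term `x ↦ h(x_i, x_j)`. -/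
theorem hasFDerivAt_coupling {ι : Type*} [Fintype ι] {k : ℝ → ℝ → ℝ}
    (hk : DifferentiableAt ℝ (fun p : ℝ × ℝ => k p.1 p.2) 0) (i j : ι) :
    HasFDerivAt (fun x : ι → ℝ => k (x i) (x j))
      (deriv (fun x => k x 0) 0 • ContinuousLinearMap.proj (R := ℝ) (φ := fun _ : ι => ℝ) i +
        deriv (fun y => k 0 y) 0 • ContinuousLinearMap.proj j) 0 := by
  have hd := hk.hasFDerivAt
  set L := fderiv ℝ (fun p : ℝ × ℝ => k p.1 p.2) 0
  have h1 : deriv (fun x => k x 0) 0 = L (1, 0) :=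
    (HasFDerivAt.comp_hasDerivAt (f := fun x : ℝ => (x, (0 : ℝ))) (0 : ℝ) hd
      ((hasDerivAt_id (0 : ℝ)).prodMk (hasDerivAt_const (0 : ℝ) (0 : ℝ)))).deriv
  have h2 : deriv (fun y => k 0 y) 0 = L (0, 1) :=
    (HasFDerivAt.comp_hasDerivAt (f := fun y : ℝ => ((0 : ℝ), y)) (0 : ℝ) hd
      ((hasDerivAt_const (0 : ℝ) (0 : ℝ)).prodMk (hasDerivAt_id (0 : ℝ)))).deriv
  have hc := HasFDerivAt.comp (f := fun x : ι → ℝ => (x i, x j)) (0 : ι → ℝ) hd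
    ((hasFDerivAt_apply i (0 : ι → ℝ)).prodMk (hasFDerivAt_apply j (0 : ι → ℝ)))
  refine hc.congr_fderiv ?_
  ext x
  have hx : (x i, x j) = x i • ((1 : ℝ), (0 : ℝ)) + x j • ((0 : ℝ), (1 : ℝ)) := by simp
  have hL : L (x i, x j) = x i * L (1, 0) + x j * L (0, 1) := by
    rw [hx, map_add, map_smul, map_smul, smul_eq_mul, smul_eq_mul]
  simpa [h1, h2, mul_comm] using hL

/-- The derivative at the origin of a component of an input-additive admissible system. -/
theorem hasFDerivAt_admissF {ι : Type*} [Fintype ι] (W : Matrix ι ι ℝ) {g : ℝ → ℝ → ℝ}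
    {h : ℝ → ℝ → ℝ → ℝ} {lam : ℝ} (hg : DifferentiableAt ℝ (fun x => g x lam) 0)
    (hh : DifferentiableAt ℝ (fun p : ℝ × ℝ => h p.1 p.2 lam) 0) (i : ι) :
    HasFDerivAt (fun x : ι → ℝ => admissF W g h x lam i)
      (deriv (fun x => g x lam) 0 • ContinuousLinearMap.proj (R := ℝ) (φ := fun _ : ι => ℝ) i +
        ∑ j, W i j •
          (deriv (fun x => h x 0 lam) 0 • ContinuousLinearMap.proj (R := ℝ) (φ := fun _ : ι => ℝ) i +
            deriv (fun y => h 0 y lam) 0 • ContinuousLinearMap.proj j)) 0 := by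
  have hgi : HasFDerivAt (fun x : ι → ℝ => g (x i) lam)
      (deriv (fun x => g x lam) 0 •
        ContinuousLinearMap.proj (R := ℝ) (φ := fun _ : ι => ℝ) i) 0 :=
    HasDerivAt.comp_hasFDerivAt (h₂ := fun x => g x lam) (f := fun x : ι → ℝ => x i)
      (0 : ι → ℝ) hg.hasDerivAt (hasFDerivAt_apply i (0 : ι → ℝ))
  exact hgi.add (HasFDerivAt.fun_sum fun j _ =>
    (hasFDerivAt_coupling (k := fun x y => h x y lam) hh i j).const_mul (W i j))

/-- For a regular network of valency `v`, if `μ₁, …, μ_n` are the complex eigenvalues of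
`W` with algebraic multiplicity, then the eigenvalues of the Jacobian `J` at the origin of
the admissible system, with algebraic multiplicity, are `g₀ + v h₁ + h₂ μ_j`. -/
theorem statement1 (n : ℕ) (hn : 1 ≤ n) (W : Matrix (Fin n) (Fin n) ℝ)
    (v : ℝ) (hreg : ∀ i, ∑ j, W i j = v)
    (g : ℝ → ℝ → ℝ) (h : ℝ → ℝ → ℝ → ℝ)
    (hg : ContDiff ℝ 1 (fun p : ℝ × ℝ => g p.1 p.2))
    (hh : ContDiff ℝ 1 (fun p : ℝ × ℝ × ℝ => h p.1 p.2.1 p.2.2))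
    (g₀ h₁ h₂ : ℝ)
    (hg₀ : g₀ = deriv (fun x => g x 0) 0)
    (hh₁ : h₁ = deriv (fun x => h x 0 0) 0)
    (hh₂ : h₂ = deriv (fun y => h 0 y 0) 0)
    (J : Matrix (Fin n) (Fin n) ℝ)
    (hJ : ∀ i j, J i j =
      fderiv ℝ (fun x : Fin n → ℝ => admissF W g h x 0 i) 0 (Pi.single j 1))
    (μ : Fin n → ℂ)
    (hμ : (W.map (algebraMap ℝ ℂ)).charpoly = ∏ j, (X - C (μ j))) :
    (J.map (algebraMap ℝ ℂ)).charpoly =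
      ∏ j, (X - C (((g₀ + v * h₁ : ℝ) : ℂ) + (h₂ : ℂ) * μ j)) := by
  have hgd : DifferentiableAt ℝ (fun x => g x 0) 0 :=
    (hg.comp (contDiff_id.prodMk contDiff_const)).differentiable one_ne_zero 0
  have hhd : DifferentiableAt ℝ (fun p : ℝ × ℝ => h p.1 p.2 0) 0 :=
    (hh.comp (contDiff_fst.prodMk (contDiff_snd.prodMk contDiff_const))).differentiable
      one_ne_zero 0
  have hJW : J = (g₀ + v * h₁) • (1 : Matrix (Fin n) (Fin n) ℝ) + h₂ • W := by
    ext i j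
    rw [hJ, (hasFDerivAt_admissF W hgd hhd i).fderiv, ← hg₀, ← hh₁, ← hh₂, ← hreg i]
    simp only [_root_.add_apply, _root_.sum_apply, _root_.smul_apply,
      ContinuousLinearMap.proj_apply, Pi.single_apply, smul_eq_mul, Matrix.add_apply,
      Matrix.smul_apply, Matrix.one_apply, mul_add, Finset.sum_add_distrib, Finset.sum_mul]
    by_cases hij : i = j <;> simp [hij, mul_comm, add_assoc]
  have hJC : J.map (algebraMap ℝ ℂ) =
      ((g₀ + v * h₁ : ℝ) : ℂ) • (1 : Matrix (Fin n) (Fin n) ℂ) +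
        (h₂ : ℂ) • W.map (algebraMap ℝ ℂ) := by
    ext i j
    by_cases hij : i = j <;> simp [hJW, hij]
  rw [hJC]
  exact charpoly_smul_one_add_smul _ μ hμ _ _
end

section
/- Let n₁, n₂ ≥ 2, let L₁ be a real n₁ × n₁ matrix, and let L₂ be a real n₂ × n₂ matrix whose first row is zero; write u ∈ ℝ^{n₂−1} for the first column of L₂ with its first entry removed and B for the (n₂−1) × (n₂−1) matrix obtained from L₂ by deleting its first row and first column. Let L be the (n₁+n₂−1) × (n₁+n₂−1) block lower-triangular matrix L = [[L₁, 0], [C, B]], where C is the (n₂−1) × n₁ matrix whose first n₁−1 columns are zero and whose last column is u. Then X · charpoly(L) = charpoly(L₁) · charpoly(L₂). In particular, the eigenvalues of L are the union of the eigenvalues of L₁ and L₂, the algebraic multiplicity of 0 for L is m¹_a(0) + m²_a(0) − 1, and the algebraic multiplicity of any μ ≠ 0 for L is m¹_a(μ) + m²_a(μ), where mⁱ_a denotes algebraic multiplicity for Lᵢ. -/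
open Matrix Polynomial

/-- If the first row of `M` is zero, its characteristic polynomial is `X` times that of the
matrix with the first row and column removed. -/
theorem Matrix.charpoly_of_first_row_eq_zero {R : Type*} [CommRing R] {n : ℕ}
    (M : Matrix (Fin (n + 1)) (Fin (n + 1)) R) (h : ∀ j, M 0 j = 0) :
    M.charpoly = X * (M.submatrix Fin.succ Fin.succ).charpoly := by
  have hsub : M.charmatrix.submatrix Fin.succ Fin.succ =
      (M.submatrix Fin.succ Fin.succ).charmatrix := by
    ext1 i j
    simp [charmatrix_apply, diagonal_apply]
  rw [charpoly, det_succ_row_zero, Fin.sum_univ_succ, Finset.sum_eq_zero, charpoly, ← hsub]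
  · simp [h, Fin.succAbove_zero]
  · intro j _
    simp [charmatrix_apply, h, diagonal_apply_ne _ (Fin.succ_ne_zero j).symm]

/-- For a feedforward coalescence network, `X · charpoly(L) = charpoly(L₁) · charpoly(L₂)`;
in particular the eigenvalues of `L` are those of `L₁` and `L₂`, with
`m_a(0) = m¹_a(0) + m²_a(0) − 1` and `m_a(μ) = m¹_a(μ) + m²_a(μ)` for `μ ≠ 0`. -/
theorem statement5 (m₁ m₂ : ℕ) (hm₁ : 1 ≤ m₁) (hm₂ : 1 ≤ m₂)
    (L₁ : Matrix (Fin (m₁ + 1)) (Fin (m₁ + 1)) ℝ)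
    (L₂ : Matrix (Fin (m₂ + 1)) (Fin (m₂ + 1)) ℝ)
    (hrow : ∀ j, L₂ 0 j = 0)
    (u : Fin m₂ → ℝ) (hu : ∀ i, u i = L₂ i.succ 0)
    (B : Matrix (Fin m₂) (Fin m₂) ℝ) (hB : ∀ i j, B i j = L₂ i.succ j.succ)
    (C : Matrix (Fin m₂) (Fin (m₁ + 1)) ℝ)
    (hC : ∀ i j, C i j = if j = Fin.last m₁ then u i else 0)
    (L : Matrix (Fin (m₁ + 1) ⊕ Fin m₂) (Fin (m₁ + 1) ⊕ Fin m₂) ℝ)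
    (hL : L = Matrix.fromBlocks L₁ 0 C B) :
    X * L.charpoly = L₁.charpoly * L₂.charpoly ∧
    ((L.charpoly.map (algebraMap ℝ ℂ)).rootMultiplicity 0 + 1 =
        (L₁.charpoly.map (algebraMap ℝ ℂ)).rootMultiplicity 0 +
          (L₂.charpoly.map (algebraMap ℝ ℂ)).rootMultiplicity 0) ∧
    ∀ μ : ℂ, μ ≠ 0 →
      (L.charpoly.map (algebraMap ℝ ℂ)).rootMultiplicity μ =
        (L₁.charpoly.map (algebraMap ℝ ℂ)).rootMultiplicity μ +
          (L₂.charpoly.map (algebraMap ℝ ℂ)).rootMultiplicity μ := by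
  have hBsub : L₂.submatrix Fin.succ Fin.succ = B := by
    ext i j
    exact (hB i j).symm
  have key : X * L.charpoly = L₁.charpoly * L₂.charpoly := by
    rw [hL, charpoly_fromBlocks_zero₁₂, L₂.charpoly_of_first_row_eq_zero hrow, hBsub]
    ring
  have mult (μ : ℂ) : (X : ℂ[X]).rootMultiplicity μ +
      (L.charpoly.map (algebraMap ℝ ℂ)).rootMultiplicity μ =
        (L₁.charpoly.map (algebraMap ℝ ℂ)).rootMultiplicity μ +
          (L₂.charpoly.map (algebraMap ℝ ℂ)).rootMultiplicity μ := by
    have h₁ := (L₁.charpoly_monic.map (algebraMap ℝ ℂ)).ne_zero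
    have h₂ := (L₂.charpoly_monic.map (algebraMap ℝ ℂ)).ne_zero
    have h := (L.charpoly_monic.map (algebraMap ℝ ℂ)).ne_zero
    rw [← rootMultiplicity_mul (mul_ne_zero X_ne_zero h),
      ← rootMultiplicity_mul (mul_ne_zero h₁ h₂), ← Polynomial.map_mul, ← key,
      Polynomial.map_mul, map_X]
  refine ⟨key, ?_, fun μ hμ => ?_⟩
  · have hX : (X : ℂ[X]).rootMultiplicity 0 = 1 := by
      simpa using rootMultiplicity_X_sub_C_self (x := (0 : ℂ))
    rw [← mult 0, hX, add_comm]
  · have hX : (X : ℂ[X]).rootMultiplicity μ = 0 :=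
      rootMultiplicity_eq_zero (by simpa using hμ)
    rw [← mult μ, hX, zero_add]
end

section
/- Let n₁, n₂ ≥ 2, let L₁ be a real n₁ × n₁ matrix, and let L₂ be a real n₂ × n₂ matrix whose first row is zero; write u ∈ ℝ^{n₂−1} for the first column of L₂ with its first entry removed and B for L₂ with its first row and column deleted. Let L = [[L₁, 0], [C, B]] be the (n₁+n₂−1)-square block matrix where C has zero first n₁−1 columns and last column u. Then for every (v, c, w) ∈ ℝ^{n₁−1} × ℝ × ℝ^{n₂−1}: L·(v, c, w) = 0 if and only if L₁·(v, c) = 0 and L₂·(c, w) = 0. -/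
open Matrix

/-- For a feedforward coalescence network with Laplacian `L = [[L₁, 0], [C, B]]`:
`L·(v, c, w) = 0` if and only if `L₁·(v, c) = 0` and `L₂·(c, w) = 0`. -/
theorem statement6 (m₁ m₂ : ℕ) (hm₁ : 1 ≤ m₁) (hm₂ : 1 ≤ m₂)
    (L₁ : Matrix (Fin (m₁ + 1)) (Fin (m₁ + 1)) ℝ)
    (L₂ : Matrix (Fin (m₂ + 1)) (Fin (m₂ + 1)) ℝ)
    (hrow : ∀ j, L₂ 0 j = 0)
    (u : Fin m₂ → ℝ) (hu : ∀ i, u i = L₂ i.succ 0)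
    (B : Matrix (Fin m₂) (Fin m₂) ℝ) (hB : ∀ i j, B i j = L₂ i.succ j.succ)
    (C : Matrix (Fin m₂) (Fin (m₁ + 1)) ℝ)
    (hC : ∀ i j, C i j = if j = Fin.last m₁ then u i else 0)
    (L : Matrix (Fin (m₁ + 1) ⊕ Fin m₂) (Fin (m₁ + 1) ⊕ Fin m₂) ℝ)
    (hL : L = Matrix.fromBlocks L₁ 0 C B) :
    ∀ (v : Fin m₁ → ℝ) (c : ℝ) (w : Fin m₂ → ℝ),
      L.mulVec (Sum.elim (Fin.snoc v c) w) = 0 ↔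
        L₁.mulVec (Fin.snoc v c) = 0 ∧ L₂.mulVec (Fin.cons c w) = 0 := by
  intro v c w
  have lower (i : Fin m₂) :
      (C *ᵥ (Fin.snoc v c : Fin (m₁ + 1) → ℝ) + B *ᵥ w) i =
        (L₂ *ᵥ (Fin.cons c w : Fin (m₂ + 1) → ℝ)) i.succ := by
    simp [Matrix.mulVec, dotProduct, hC, hB, hu, Fin.sum_univ_succ]
  have first : (L₂ *ᵥ (Fin.cons c w : Fin (m₂ + 1) → ℝ)) 0 = 0 := by
    simp [Matrix.mulVec, dotProduct, hrow]
  rw [hL, Matrix.fromBlocks_mulVec]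
  simp only [Sum.elim_comp_inl, Sum.elim_comp_inr, Matrix.zero_mulVec, add_zero]
  simp only [funext_iff, Sum.forall, Sum.elim_inl, Sum.elim_inr, lower, Pi.zero_apply,
    Fin.forall_fin_succ (P := fun i => (L₂ *ᵥ (Fin.cons c w : Fin (m₂ + 1) → ℝ)) i = 0),
    first, true_and]
end

section
/- Let n₁, n₂ ≥ 2, let L₁ be a real n₁ × n₁ matrix, let L₂ be a real n₂ × n₂ matrix whose first row is zero, with B equal to L₂ with its first row and column deleted and u its first column with first entry removed, and let L = [[L₁, 0], [C, B]] be the (n₁+n₂−1)-square block matrix where C has zero first n₁−1 columns and last column u. Let μ ≠ 0 and let (v, c) ∈ ℝ^{n₁−1} × ℝ with (v, c) ≠ (0, 0). Then there exists w ∈ ℝ^{n₂−1} such that (v, c, w) is a generalized eigenvector of L associated with μ if and only if (v, c) is a generalized eigenvector of L₁ associated with μ. -/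
open Matrix

/-- `x` is a generalized eigenvector of the square real matrix `M` associated with `μ`
if `x ≠ 0` and `(M − μI)^k x = 0` for some integer `k ≥ 1`. -/
def IsGenEigenvector {ι : Type*} [Fintype ι] [DecidableEq ι]
    (M : Matrix ι ι ℝ) (μ : ℝ) (x : ι → ℝ) : Prop :=
  x ≠ 0 ∧ ∃ k : ℕ, 1 ≤ k ∧ ((M - μ • (1 : Matrix ι ι ℝ)) ^ k).mulVec x = 0

namespace Matrix

variable {m n R : Type*} [Fintype m] [Fintype n] [DecidableEq m] [DecidableEq n]

/-- Powers of a block lower triangular matrix are block lower triangular. -/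
theorem exists_fromBlocks_zero₁₂_pow [Semiring R] (A : Matrix m m R) (C : Matrix n m R)
    (D : Matrix n n R) (k : ℕ) :
    ∃ E : Matrix n m R, fromBlocks A 0 C D ^ k = fromBlocks (A ^ k) 0 E (D ^ k) := by
  induction k with
  | zero => exact ⟨0, by simp [fromBlocks_one]⟩
  | succ k ih =>
    obtain ⟨E, hE⟩ := ih
    exact ⟨E * A + D ^ k * C, by simp [pow_succ, hE, fromBlocks_multiply]⟩

/-- The column spaces of the powers of a square matrix over a field stabilize. -/
theorem exists_forall_pow_add_mulVec_eq {K : Type*} [Field K] (D : Matrix n n K) :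
    ∃ j : ℕ, ∀ (k : ℕ) (y : n → K), ∃ w, (D ^ (k + j)) *ᵥ w = (D ^ j) *ᵥ y := by
  obtain ⟨j, hj⟩ := Filter.eventually_atTop.mp D.toLin'.eventually_iInf_range_pow_eq
  refine ⟨j, fun k y => ?_⟩
  have hr : LinearMap.range (D.toLin' ^ j) = LinearMap.range (D.toLin' ^ (k + j)) :=
    (hj j le_rfl).symm.trans (hj (k + j) (Nat.le_add_left j k))
  have hy : (D.toLin' ^ j) y ∈ LinearMap.range (D.toLin' ^ (k + j)) := hr ▸ ⟨y, rfl⟩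
  obtain ⟨w, hw⟩ := hy
  exact ⟨w, by simpa only [← toLin'_pow, toLin'_apply] using hw⟩

/-- A vector killed by a power of the first diagonal block of a block lower triangular matrix
extends to a vector killed by a power of the whole matrix. -/
theorem exists_fromBlocks_zero₁₂_pow_mulVec_eq_zero {K : Type*} [Field K] (A : Matrix m m K)
    (C : Matrix n m K) (D : Matrix n n K) {k : ℕ} {x : m → K} (hx : (A ^ k) *ᵥ x = 0) :
    ∃ (w : n → K) (j : ℕ), (fromBlocks A 0 C D ^ (j + k)) *ᵥ Sum.elim x w = 0 := by
  obtain ⟨E, hE⟩ := exists_fromBlocks_zero₁₂_pow A C D k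
  obtain ⟨j, hj⟩ := exists_forall_pow_add_mulVec_eq D
  obtain ⟨F, hF⟩ := exists_fromBlocks_zero₁₂_pow A C D j
  obtain ⟨w, hw⟩ := hj k (-(E *ᵥ x))
  refine ⟨w, j, ?_⟩
  rw [pow_add, ← mulVec_mulVec, hE, hF, fromBlocks_mulVec, fromBlocks_mulVec]
  rw [add_comm k j, pow_add, ← mulVec_mulVec] at hw
  simp [hx, mulVec_add, hw, mulVec_neg]

end Matrix

/-- For a feedforward coalescence network with Laplacian `L = [[L₁, 0], [C, B]]` and
`μ ≠ 0`: for `(v, c) ≠ (0, 0)`, there is `w` such that `(v, c, w)` is a generalized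
eigenvector of `L` associated with `μ` iff `(v, c)` is a generalized eigenvector of `L₁`
associated with `μ`. -/
theorem statement8 (m₁ m₂ : ℕ) (hm₁ : 1 ≤ m₁) (hm₂ : 1 ≤ m₂)
    (L₁ : Matrix (Fin (m₁ + 1)) (Fin (m₁ + 1)) ℝ)
    (L₂ : Matrix (Fin (m₂ + 1)) (Fin (m₂ + 1)) ℝ)
    (hrow : ∀ j, L₂ 0 j = 0)
    (u : Fin m₂ → ℝ) (hu : ∀ i, u i = L₂ i.succ 0)
    (B : Matrix (Fin m₂) (Fin m₂) ℝ) (hB : ∀ i j, B i j = L₂ i.succ j.succ)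
    (C : Matrix (Fin m₂) (Fin (m₁ + 1)) ℝ)
    (hC : ∀ i j, C i j = if j = Fin.last m₁ then u i else 0)
    (L : Matrix (Fin (m₁ + 1) ⊕ Fin m₂) (Fin (m₁ + 1) ⊕ Fin m₂) ℝ)
    (hL : L = Matrix.fromBlocks L₁ 0 C B)
    (μ : ℝ) (hμ : μ ≠ 0)
    (v : Fin m₁ → ℝ) (c : ℝ)
    (hvc : (Fin.snoc v c : Fin (m₁ + 1) → ℝ) ≠ 0) :
    (∃ w : Fin m₂ → ℝ, IsGenEigenvector L μ (Sum.elim (Fin.snoc v c) w)) ↔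
      IsGenEigenvector L₁ μ (Fin.snoc v c) := by
  have hM : L - μ • (1 : Matrix _ _ ℝ) =
      fromBlocks (L₁ - μ • (1 : Matrix _ _ ℝ)) 0 C (B - μ • (1 : Matrix _ _ ℝ)) := by
    rw [hL, ← fromBlocks_one, fromBlocks_smul, sub_eq_add_neg, fromBlocks_neg, fromBlocks_add]
    simp [sub_eq_add_neg]
  constructor
  · rintro ⟨w, -, k, hk, h⟩
    refine ⟨hvc, k, hk, ?_⟩
    obtain ⟨E, hE⟩ := exists_fromBlocks_zero₁₂_pow (L₁ - μ • (1 : Matrix _ _ ℝ)) C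
      (B - μ • (1 : Matrix _ _ ℝ)) k
    rw [hM, hE, fromBlocks_mulVec] at h
    ext i
    simpa using congrFun h (Sum.inl i)
  · rintro ⟨-, k, hk, h⟩
    obtain ⟨w, j, hw⟩ := exists_fromBlocks_zero₁₂_pow_mulVec_eq_zero _ C
      (B - μ • (1 : Matrix _ _ ℝ)) h
    refine ⟨w, fun h0 => hvc ?_, j + k, by omega, by rw [hM, hw]⟩
    ext i
    exact congrFun h0 (Sum.inl i)
end

section
/- Let n₁, n₂ ≥ 2, let L₁ be a real n₁ × n₁ matrix, let L₂ be a real n₂ × n₂ matrix whose first row is zero, with B equal to L₂ with its first row and column deleted and u its first column with first entry removed, and let L = [[L₁, 0], [C, B]] be the (n₁+n₂−1)-square block matrix where C has zero first n₁−1 columns and last column u. Let μ ≠ 0 and let w ∈ ℝ^{n₂−1} with w ≠ 0. Then (0, 0, w) ∈ ℝ^{n₁−1} × ℝ × ℝ^{n₂−1} is a generalized eigenvector of L associated with μ if and only if (0, w) ∈ ℝ × ℝ^{n₂−1} is a generalized eigenvector of L₂ associated with μ. -/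
open Matrix

/-- An injective linear map intertwining `B` and `M` preserves and reflects generalized
eigenvectors. -/
theorem isGenEigenvector_map_iff {ι κ : Type*} [Fintype ι] [DecidableEq ι] [Fintype κ]
    [DecidableEq κ] {M : Matrix ι ι ℝ} {B : Matrix κ κ ℝ} (e : (κ → ℝ) →ₗ[ℝ] (ι → ℝ))
    (he : Function.Injective e) (h : ∀ w, M.mulVec (e w) = e (B.mulVec w)) (μ : ℝ)
    (w : κ → ℝ) : IsGenEigenvector M μ (e w) ↔ IsGenEigenvector B μ w := by
  have hpow (k : ℕ) (v : κ → ℝ) :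
      ((M - μ • (1 : Matrix ι ι ℝ)) ^ k).mulVec (e v) =
        e (((B - μ • (1 : Matrix κ κ ℝ)) ^ k).mulVec v) := by
    induction k generalizing v with
    | zero => simp
    | succ k ih =>
      have hstep : (M - μ • (1 : Matrix ι ι ℝ)).mulVec (e v) =
          e ((B - μ • (1 : Matrix κ κ ℝ)).mulVec v) := by
        simp [sub_mulVec, smul_mulVec, h]
      rw [pow_succ, pow_succ, ← mulVec_mulVec, ← mulVec_mulVec, hstep, ih]
  simp only [IsGenEigenvector, hpow, ne_eq, map_eq_zero_iff e he]

/-- A vector supported on the second block is a generalized eigenvector of a lower block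
triangular matrix iff it is one of the second diagonal block. -/
theorem isGenEigenvector_fromBlocks_iff {ι κ : Type*} [Fintype ι] [DecidableEq ι] [Fintype κ]
    [DecidableEq κ] (A : Matrix ι ι ℝ) (C : Matrix κ ι ℝ) (B : Matrix κ κ ℝ) (μ : ℝ)
    (w : κ → ℝ) :
    IsGenEigenvector (fromBlocks A 0 C B) μ (Sum.elim (fun _ => 0) w) ↔
      IsGenEigenvector B μ w := by
  let e : (κ → ℝ) →ₗ[ℝ] (ι ⊕ κ → ℝ) :=
    { toFun := Sum.elim (fun _ => 0)
      map_add' := fun x y => by ext (i | i) <;> simp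
      map_smul' := fun c x => by ext (i | i) <;> simp }
  refine isGenEigenvector_map_iff e (fun x y hxy => ?_) (fun v => ?_) μ w
  · ext i
    exact congrFun hxy (Sum.inr i)
  · ext (i | i) <;> simp [e, mulVec, dotProduct]

/-- A vector with zero first entry is a generalized eigenvector of a matrix with zero first row
iff its tail is one of the matrix with first row and column deleted. -/
theorem isGenEigenvector_cons_zero_iff {n : ℕ} {M : Matrix (Fin (n + 1)) (Fin (n + 1)) ℝ}
    (hrow : ∀ j, M 0 j = 0) (μ : ℝ) (w : Fin n → ℝ) :
    IsGenEigenvector M μ (Fin.cons 0 w) ↔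
      IsGenEigenvector (M.submatrix Fin.succ Fin.succ) μ w := by
  let e : (Fin n → ℝ) →ₗ[ℝ] (Fin (n + 1) → ℝ) :=
    { toFun := fun v => Fin.cons 0 v
      map_add' := fun x y => by ext i; cases i using Fin.cases <;> simp
      map_smul' := fun c x => by ext i; cases i using Fin.cases <;> simp }
  refine isGenEigenvector_map_iff e (fun x y hxy => ?_) (fun v => ?_) μ w
  · ext i
    exact congrFun hxy i.succ
  · ext i
    cases i using Fin.cases <;> simp [e, mulVec, dotProduct, Fin.sum_univ_succ, hrow]

/-- For a feedforward coalescence network with Laplacian `L = [[L₁, 0], [C, B]]` and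
`μ ≠ 0`: for `w ≠ 0`, `(0, 0, w)` is a generalized eigenvector of `L` associated with `μ`
iff `(0, w)` is a generalized eigenvector of `L₂` associated with `μ`. -/
theorem statement9 (m₁ m₂ : ℕ) (hm₁ : 1 ≤ m₁) (hm₂ : 1 ≤ m₂)
    (L₁ : Matrix (Fin (m₁ + 1)) (Fin (m₁ + 1)) ℝ)
    (L₂ : Matrix (Fin (m₂ + 1)) (Fin (m₂ + 1)) ℝ)
    (hrow : ∀ j, L₂ 0 j = 0)
    (u : Fin m₂ → ℝ) (hu : ∀ i, u i = L₂ i.succ 0)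
    (B : Matrix (Fin m₂) (Fin m₂) ℝ) (hB : ∀ i j, B i j = L₂ i.succ j.succ)
    (C : Matrix (Fin m₂) (Fin (m₁ + 1)) ℝ)
    (hC : ∀ i j, C i j = if j = Fin.last m₁ then u i else 0)
    (L : Matrix (Fin (m₁ + 1) ⊕ Fin m₂) (Fin (m₁ + 1) ⊕ Fin m₂) ℝ)
    (hL : L = Matrix.fromBlocks L₁ 0 C B)
    (μ : ℝ) (hμ : μ ≠ 0)
    (w : Fin m₂ → ℝ) (hw : w ≠ 0) :
    IsGenEigenvector L μ (Sum.elim (fun _ => 0) w) ↔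
      IsGenEigenvector L₂ μ (Fin.cons 0 w) := by
  have hsub : B = L₂.submatrix Fin.succ Fin.succ := by
    ext i j
    exact hB i j
  rw [hL, isGenEigenvector_fromBlocks_iff, isGenEigenvector_cons_zero_iff hrow, hsub]
end

section
/- Let n₁, n₂ ≥ 2, let L₁ be a real n₁ × n₁ matrix, let L₂ be a real n₂ × n₂ matrix whose first row is zero, with B equal to L₂ with its first row and column deleted and u its first column with first entry removed, and let L = [[L₁, 0], [C, B]] be the (n₁+n₂−1)-square block matrix where C has zero first n₁−1 columns and last column u. Suppose (v₁, c₁), …, (v_{g₁}, c_{g₁}) ∈ ℝ^{n₁−1} × ℝ is a basis of ker L₁ and (1, w₁), (0, w₂), …, (0, w_{g₂}) ∈ ℝ × ℝ^{n₂−1} is a basis of ker L₂ (whose first vector has first coordinate 1 and whose remaining vectors have first coordinate 0). Then there exist ŵ₁, …, ŵ_{g₁} ∈ ℝ^{n₂−1} such that the vectors (v₁, c₁, ŵ₁), …, (v_{g₁}, c_{g₁}, ŵ_{g₁}), (0, 0, w₂), …, (0, 0, w_{g₂}) form a basis of ker L. -/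
open Matrix

/-- Given a basis `(v₁,c₁), …, (v_{g₁},c_{g₁})` of `ker L₁` and a basis
`(1,w₀), (0,w_1), …, (0,w_{g₂-1})` of `ker L₂`, there exist `wHat₁, …, wHat_{g₁}` such that
`(vᵢ,cᵢ,wHatᵢ)` together with `(0,0,w_j)` (for `j ≥ 1`) form a basis of `ker L`, where
`L = [[L₁, 0], [C, B]]` is the Laplacian of the feedforward coalescence network. -/
theorem statement10 (m₁ m₂ : ℕ) (hm₁ : 1 ≤ m₁) (hm₂ : 1 ≤ m₂)
    (L₁ : Matrix (Fin (m₁ + 1)) (Fin (m₁ + 1)) ℝ)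
    (L₂ : Matrix (Fin (m₂ + 1)) (Fin (m₂ + 1)) ℝ)
    (hrow : ∀ j, L₂ 0 j = 0)
    (u : Fin m₂ → ℝ) (hu : ∀ i, u i = L₂ i.succ 0)
    (B : Matrix (Fin m₂) (Fin m₂) ℝ) (hB : ∀ i j, B i j = L₂ i.succ j.succ)
    (C : Matrix (Fin m₂) (Fin (m₁ + 1)) ℝ)
    (hC : ∀ i j, C i j = if j = Fin.last m₁ then u i else 0)
    (L : Matrix (Fin (m₁ + 1) ⊕ Fin m₂) (Fin (m₁ + 1) ⊕ Fin m₂) ℝ)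
    (hL : L = Matrix.fromBlocks L₁ 0 C B)
    (g₁ g₂' : ℕ)
    (v : Fin g₁ → Fin m₁ → ℝ) (c : Fin g₁ → ℝ)
    (hV₁ : LinearIndependent ℝ fun i => (Fin.snoc (v i) (c i) : Fin (m₁ + 1) → ℝ))
    (hV₂ : Submodule.span ℝ
        (Set.range fun i => (Fin.snoc (v i) (c i) : Fin (m₁ + 1) → ℝ)) =
      LinearMap.ker L₁.mulVecLin)
    (w₀ : Fin m₂ → ℝ) (ws : Fin g₂' → Fin m₂ → ℝ)
    (hK₁ : LinearIndependent ℝ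
      (Fin.cons (Fin.cons 1 w₀) (fun i => Fin.cons 0 (ws i)) :
        Fin (g₂' + 1) → Fin (m₂ + 1) → ℝ))
    (hK₂ : Submodule.span ℝ
        (Set.range (Fin.cons (Fin.cons 1 w₀) (fun i => Fin.cons 0 (ws i)) :
          Fin (g₂' + 1) → Fin (m₂ + 1) → ℝ)) =
      LinearMap.ker L₂.mulVecLin) :
    ∃ wHat : Fin g₁ → Fin m₂ → ℝ,
      LinearIndependent ℝ
        (Sum.elim (fun i => Sum.elim (Fin.snoc (v i) (c i)) (wHat i))
          (fun j => Sum.elim 0 (ws j)) :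
          Fin g₁ ⊕ Fin g₂' → Fin (m₁ + 1) ⊕ Fin m₂ → ℝ) ∧
      Submodule.span ℝ
          (Set.range (Sum.elim (fun i => Sum.elim (Fin.snoc (v i) (c i)) (wHat i))
            (fun j => Sum.elim 0 (ws j)) :
            Fin g₁ ⊕ Fin g₂' → Fin (m₁ + 1) ⊕ Fin m₂ → ℝ)) =
        LinearMap.ker L.mulVecLin := by
  have hker₂ (t : ℝ) (y : Fin m₂ → ℝ) :
      (Fin.cons t y : Fin (m₂ + 1) → ℝ) ∈ LinearMap.ker L₂.mulVecLin ↔ t • u + B *ᵥ y = 0 := by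
    rw [LinearMap.mem_ker, Matrix.mulVecLin_apply, funext_iff, funext_iff, Fin.forall_fin_succ]
    simp [Matrix.mulVec, dotProduct, Fin.sum_univ_succ, hrow, hu, hB, mul_comm t]
  have hCmul (x : Fin (m₁ + 1) → ℝ) : C *ᵥ x = x (Fin.last m₁) • u := by
    ext i
    simp [Matrix.mulVec, dotProduct, hC, mul_comm]
  have hkerL (x : Fin (m₁ + 1) → ℝ) (y : Fin m₂ → ℝ) :
      Sum.elim x y ∈ LinearMap.ker L.mulVecLin ↔
        x ∈ LinearMap.ker L₁.mulVecLin ∧ x (Fin.last m₁) • u + B *ᵥ y = 0 := by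
    rw [LinearMap.mem_ker, LinearMap.mem_ker, Matrix.mulVecLin_apply, Matrix.mulVecLin_apply, hL,
      Matrix.fromBlocks_mulVec, Sum.elim_comp_inl, Sum.elim_comp_inr, hCmul, Matrix.zero_mulVec,
      add_zero, ← Sum.elim_zero_zero, Sum.elim_eq_iff]
  have hw₀ : u + B *ᵥ w₀ = 0 := by
    have h := (hker₂ 1 w₀).1 (hK₂ ▸ Submodule.subset_span ⟨0, rfl⟩)
    rwa [one_smul] at h
  have hws (j : Fin g₂') : B *ᵥ ws j = 0 := by
    have h := (hker₂ 0 (ws j)).1 (hK₂ ▸ Submodule.subset_span ⟨j.succ, rfl⟩)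
    rwa [zero_smul, zero_add] at h
  have hwsli (b : Fin g₂' → ℝ) (hb : ∑ j, b j • ws j = 0) (j : Fin g₂') : b j = 0 := by
    refine Fintype.linearIndependent_iff.1 hK₁ (Fin.cons 0 b) ?_ j.succ
    rw [Fin.sum_univ_succ]
    ext i
    refine Fin.cases ?_ (fun i => ?_) i
    · simp [Finset.sum_apply]
    · simpa [Finset.sum_apply] using congrFun hb i
  have hkerB (y : Fin m₂ → ℝ) (hy : B *ᵥ y = 0) : ∃ b : Fin g₂' → ℝ, ∑ j, b j • ws j = y := by
    have h := (hker₂ 0 y).2 (by rw [zero_smul, zero_add, hy])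
    rw [← hK₂, Submodule.mem_span_range_iff_exists_fun] at h
    obtain ⟨b, hb⟩ := h
    rw [Fin.sum_univ_succ] at hb
    have hb₀ : b 0 = 0 := by simpa [Finset.sum_apply] using congrFun hb 0
    refine ⟨fun j => b j.succ, funext fun i => ?_⟩
    simpa [Finset.sum_apply, hb₀] using congrFun hb i.succ
  refine ⟨fun i => c i • w₀, ?_, le_antisymm ?_ ?_⟩
  · rw [Fintype.linearIndependent_iff]
    intro a ha
    rw [Fintype.sum_sum_type] at ha
    have ha₁ : ∀ i, a (Sum.inl i) = 0 := by
      refine Fintype.linearIndependent_iff.1 hV₁ (fun i => a (Sum.inl i)) (funext fun k => ?_)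
      simpa [Finset.sum_apply] using congrFun ha (Sum.inl k)
    have ha₂ : ∀ j, a (Sum.inr j) = 0 := by
      refine hwsli (fun j => a (Sum.inr j)) (funext fun k => ?_)
      simpa [Finset.sum_apply, ha₁] using congrFun ha (Sum.inr k)
    exact Sum.rec ha₁ ha₂
  · rw [Submodule.span_le]
    rintro _ ⟨i | j, rfl⟩
    · refine (hkerL _ _).2 ⟨hV₂ ▸ Submodule.subset_span ⟨i, rfl⟩, ?_⟩
      rw [Fin.snoc_last, Matrix.mulVec_smul, ← smul_add, hw₀, smul_zero]
    · refine (hkerL _ _).2 ⟨Submodule.zero_mem _, ?_⟩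
      rw [hws, Pi.zero_apply, zero_smul, zero_add]
  · intro z hz
    obtain ⟨x, y, rfl⟩ : ∃ x y, z = Sum.elim x y := ⟨_, _, (Sum.elim_comp_inl_inr z).symm⟩
    obtain ⟨hx, hy⟩ := (hkerL x y).1 hz
    rw [← hV₂, Submodule.mem_span_range_iff_exists_fun] at hx
    obtain ⟨a, rfl⟩ := hx
    obtain ⟨b, hb⟩ := hkerB (y - (∑ i, a i * c i) • w₀) (by
      have hBw₀ : B *ᵥ w₀ = -u := eq_neg_of_add_eq_zero_right hw₀
      rw [Matrix.mulVec_sub, Matrix.mulVec_smul, hBw₀, smul_neg, sub_neg_eq_add, add_comm]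
      simpa [Finset.sum_apply] using hy)
    rw [Submodule.mem_span_range_iff_exists_fun]
    refine ⟨Sum.elim a b, ?_⟩
    rw [Fintype.sum_sum_type]
    ext (k | k)
    · simp [Finset.sum_apply]
    · have h := congrFun hb k
      simp only [Finset.sum_apply, Pi.smul_apply, Pi.sub_apply, smul_eq_mul] at h
      simp [Finset.sum_apply, h, Finset.sum_mul, mul_assoc]
end

section
/- Let n₁, n₂ ≥ 2, let L₁ be a real n₁ × n₁ matrix, let L₂ be a real n₂ × n₂ matrix whose first row is zero, with B equal to L₂ with its first row and column deleted and u ∈ ℝ^{n₂−1} its first column with first entry removed, and let L = [[L₁, 0], [C, B]] be the (n₁+n₂−1)-square block matrix where C has zero first n₁−1 columns and last column u. Let μ ≠ 0 and assume u ∈ Im(B − μI). Then μ is a semisimple eigenvalue of L if and only if μ is a semisimple eigenvalue of both L₁ and L₂; equivalently, ker((L − μI)²) = ker(L − μI) if and only if ker((L₁ − μI)²) = ker(L₁ − μI) and ker((L₂ − μI)²) = ker(L₂ − μI). -/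
open Matrix

/-- `ker (M ^ 2) = ker M`, stated on vectors. -/
theorem ker_sq_mulVecLin_eq_iff {n : Type*} [Fintype n] [DecidableEq n] (M : Matrix n n ℝ) :
    LinearMap.ker ((M ^ 2).mulVecLin) = LinearMap.ker M.mulVecLin ↔
      ∀ x, M *ᵥ (M *ᵥ x) = 0 → M *ᵥ x = 0 := by
  constructor
  · intro h x hx
    have hmem : x ∈ LinearMap.ker ((M ^ 2).mulVecLin) := by
      simpa [pow_two, ← Matrix.mulVec_mulVec] using hx
    rw [h] at hmem
    simpa using hmem
  · intro h
    ext x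
    simp only [LinearMap.mem_ker, Matrix.mulVecLin_apply, pow_two, ← Matrix.mulVec_mulVec]
    exact ⟨h x, fun hx => by rw [hx, Matrix.mulVec_zero]⟩

/-- If `ker (D ^ 2) = ker D`, then every vector in the image of `D` is in the image of `D ^ 2`. -/
theorem exists_mulVec_mulVec_eq {n : Type*} [Fintype n] [DecidableEq n] (D : Matrix n n ℝ)
    (h : ∀ x, D *ᵥ (D *ᵥ x) = 0 → D *ᵥ x = 0) (y : n → ℝ) :
    ∃ z, D *ᵥ (D *ᵥ z) = D *ᵥ y := by
  have hker := (ker_sq_mulVecLin_eq_iff D).2 h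
  have hle : LinearMap.range ((D ^ 2).mulVecLin) ≤ LinearMap.range D.mulVecLin := by
    rintro _ ⟨x, rfl⟩
    exact ⟨D *ᵥ x, by simp [pow_two]⟩
  have hrank := LinearMap.finrank_range_add_finrank_ker ((D ^ 2).mulVecLin)
  have hrank' := LinearMap.finrank_range_add_finrank_ker D.mulVecLin
  rw [hker] at hrank
  have heq := Submodule.eq_of_le_of_finrank_eq hle (by omega)
  have hmem : D *ᵥ y ∈ LinearMap.range ((D ^ 2).mulVecLin) := by
    rw [heq]
    exact ⟨y, rfl⟩
  obtain ⟨z, hz⟩ := hmem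
  exact ⟨z, by simpa [pow_two] using hz⟩

/-- A block lower triangular matrix whose off-diagonal block factors through `D` satisfies
`ker (M ^ 2) = ker M` iff both diagonal blocks do. -/
theorem ker_sq_fromBlocks_mul_iff {m n : Type*} [Fintype m] [Fintype n] [DecidableEq n]
    (A : Matrix m m ℝ) (D : Matrix n n ℝ) (P : Matrix n m ℝ) :
    (∀ x, fromBlocks A 0 (D * P) D *ᵥ (fromBlocks A 0 (D * P) D *ᵥ x) = 0 →
        fromBlocks A 0 (D * P) D *ᵥ x = 0) ↔
      (∀ v, A *ᵥ (A *ᵥ v) = 0 → A *ᵥ v = 0) ∧ ∀ w, D *ᵥ (D *ᵥ w) = 0 → D *ᵥ w = 0 := by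
  have hM : ∀ v w, fromBlocks A 0 (D * P) D *ᵥ Sum.elim v w =
      Sum.elim (A *ᵥ v) (D *ᵥ (P *ᵥ v + w)) := fun v w => by
    rw [Matrix.fromBlocks_mulVec]
    simp [Matrix.mulVec_add]
  have hzero : ∀ (v : m → ℝ) (w : n → ℝ), Sum.elim v w = 0 ↔ v = 0 ∧ w = 0 := fun v w => by
    simp [funext_iff]
  constructor
  · intro h
    have hD : ∀ w, D *ᵥ (D *ᵥ w) = 0 → D *ᵥ w = 0 := fun w hw => by
      have := h (Sum.elim 0 w)
      simp only [hM, hzero, Matrix.mulVec_zero, zero_add, true_and] at this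
      exact this hw
    refine ⟨fun v hv => ?_, hD⟩
    obtain ⟨z, hz⟩ := exists_mulVec_mulVec_eq D hD (-(P *ᵥ (A *ᵥ v)))
    have := h (Sum.elim v (z - P *ᵥ v))
    simp only [hM, hzero, add_sub_cancel] at this
    refine (this ⟨hv, ?_⟩).1
    rw [Matrix.mulVec_add, hz, ← Matrix.mulVec_add, add_neg_cancel, Matrix.mulVec_zero]
  · rintro ⟨hA, hD⟩ x hx
    obtain ⟨v, w, rfl⟩ : ∃ v w, x = Sum.elim v w :=
      ⟨x ∘ Sum.inl, x ∘ Sum.inr, (Sum.elim_comp_inl_inr x).symm⟩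
    simp only [hM, hzero] at hx ⊢
    have hv := hA v hx.1
    refine ⟨hv, hD _ ?_⟩
    simpa [hv] using hx.2

/-- If the first row of `M` is `(c, 0, …, 0)` with `c ≠ 0`, then `ker (M ^ 2) = ker M` iff the
same holds for the lower right block. -/
theorem ker_sq_succ_block_iff {k : ℕ} (M : Matrix (Fin (k + 1)) (Fin (k + 1)) ℝ) (c : ℝ)
    (hc : c ≠ 0) (h₀ : M 0 0 = c) (hrow : ∀ j : Fin k, M 0 j.succ = 0)
    (D : Matrix (Fin k) (Fin k) ℝ) (hD : ∀ i j, D i j = M i.succ j.succ) :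
    (∀ x, M *ᵥ (M *ᵥ x) = 0 → M *ᵥ x = 0) ↔ ∀ w, D *ᵥ (D *ᵥ w) = 0 → D *ᵥ w = 0 := by
  have hfirst : ∀ x, (M *ᵥ x) 0 = c * x 0 := fun x => by
    simp [Matrix.mulVec, dotProduct, Fin.sum_univ_succ, h₀, hrow]
  have hcons : ∀ w, M *ᵥ (Fin.cons 0 w : Fin (k + 1) → ℝ) = Fin.cons 0 (D *ᵥ w) := fun w => by
    ext i
    refine Fin.cases ?_ (fun i => ?_) i
    · simp [hfirst]
    · simp [Matrix.mulVec, dotProduct, Fin.sum_univ_succ, hD]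
  have hzero : ∀ w : Fin k → ℝ, (Fin.cons 0 w : Fin (k + 1) → ℝ) = 0 ↔ w = 0 := fun w => by
    simp [funext_iff, Fin.forall_fin_succ]
  constructor
  · intro h w hw
    have := h (Fin.cons 0 w)
    simp only [hcons, hzero] at this
    exact this hw
  · intro h x hx
    have hx₀ : x 0 = 0 := by
      have := congrFun hx 0
      simpa [hfirst, hc] using this
    have hx' : x = Fin.cons 0 (Fin.tail x) := by
      rw [← hx₀, Fin.cons_self_tail]
    rw [hx'] at hx ⊢
    simp only [hcons, hzero] at hx ⊢
    exact h _ hx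


/-- For a feedforward coalescence network with Laplacian `L = [[L₁, 0], [C, B]]`,
`μ ≠ 0` and `u ∈ Im(B − μI)`: `μ` is a semisimple eigenvalue of `L` iff it is a
semisimple eigenvalue of both `L₁` and `L₂`, where semisimplicity of `μ` for a
matrix `M` is expressed as `ker((M − μI)²) = ker(M − μI)`. -/
theorem statement12 (m₁ m₂ : ℕ) (hm₁ : 1 ≤ m₁) (hm₂ : 1 ≤ m₂)
    (L₁ : Matrix (Fin (m₁ + 1)) (Fin (m₁ + 1)) ℝ)
    (L₂ : Matrix (Fin (m₂ + 1)) (Fin (m₂ + 1)) ℝ)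
    (hrow : ∀ j, L₂ 0 j = 0)
    (u : Fin m₂ → ℝ) (hu : ∀ i, u i = L₂ i.succ 0)
    (B : Matrix (Fin m₂) (Fin m₂) ℝ) (hB : ∀ i j, B i j = L₂ i.succ j.succ)
    (C : Matrix (Fin m₂) (Fin (m₁ + 1)) ℝ)
    (hC : ∀ i j, C i j = if j = Fin.last m₁ then u i else 0)
    (L : Matrix (Fin (m₁ + 1) ⊕ Fin m₂) (Fin (m₁ + 1) ⊕ Fin m₂) ℝ)
    (hL : L = Matrix.fromBlocks L₁ 0 C B)
    (μ : ℝ) (hμ : μ ≠ 0)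
    (hrange : ∃ x : Fin m₂ → ℝ, (B - μ • (1 : Matrix (Fin m₂) (Fin m₂) ℝ)).mulVec x = u) :
    (LinearMap.ker (((L - μ • 1) ^ 2).mulVecLin) = LinearMap.ker ((L - μ • 1).mulVecLin)) ↔
      ((LinearMap.ker (((L₁ - μ • 1) ^ 2).mulVecLin) =
          LinearMap.ker ((L₁ - μ • 1).mulVecLin)) ∧
        (LinearMap.ker (((L₂ - μ • 1) ^ 2).mulVecLin) =
          LinearMap.ker ((L₂ - μ • 1).mulVecLin))) := by
  obtain ⟨x, hx⟩ := hrange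
  let P : Matrix (Fin m₂) (Fin (m₁ + 1)) ℝ := fun i j => if j = Fin.last m₁ then x i else 0
  have hP : C = (B - μ • 1) * P := by
    ext i j
    rw [hC, ← hx, Matrix.mul_apply]
    by_cases hj : j = Fin.last m₁ <;> simp [P, hj, Matrix.mulVec, dotProduct]
  have hblock : L - μ • 1 = fromBlocks (L₁ - μ • 1) 0 ((B - μ • 1) * P) (B - μ • 1) := by
    rw [← hP, hL, ← Matrix.fromBlocks_one, Matrix.fromBlocks_smul, sub_eq_add_neg,
      Matrix.fromBlocks_neg, Matrix.fromBlocks_add]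
    simp [sub_eq_add_neg]
  have hsucc := ker_sq_succ_block_iff (L₂ - μ • 1) (-μ) (neg_ne_zero.2 hμ) (by simp [hrow])
    (fun j => by simp [hrow, (Fin.succ_ne_zero j).symm]) (B - μ • 1)
    (fun i j => by simp [hB, Matrix.one_apply])
  rw [ker_sq_mulVecLin_eq_iff, ker_sq_mulVecLin_eq_iff, ker_sq_mulVecLin_eq_iff, hsucc, hblock]
  exact ker_sq_fromBlocks_mul_iff _ _ _
end

section
/- Let n₁, n₂ ≥ 2, let L₁ be a real n₁ × n₁ matrix, let L₂ be a real n₂ × n₂ matrix whose first row is zero, with B equal to L₂ with its first row and column deleted and u ∈ ℝ^{n₂−1} its first column with first entry removed, and let L = [[L₁, 0], [C, B]] be the (n₁+n₂−1)-square block matrix where C has zero first n₁−1 columns and last column u. Let μ ≠ 0 and assume u ∉ Im(B − μI). If L₁ has an eigenvector (v₁, v_c) ∈ ℝ^{n₁−1} × ℝ associated with μ whose last coordinate v_c is nonzero, then μ is not a semisimple eigenvalue of L, i.e., ker((L − μI)²) ≠ ker(L − μI). -/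
open Matrix

/-- If `A *ᵥ A *ᵥ w = 0` forces `A *ᵥ w = 0`, then every vector is the sum of a kernel vector and
a vector in the range of `A`. -/
lemma exists_ker_add_range {K n : Type*} [Field K] [Fintype n] (A : Matrix n n K)
    (hA : ∀ w, A *ᵥ (A *ᵥ w) = 0 → A *ᵥ w = 0) (u : n → K) :
    ∃ k w, A *ᵥ k = 0 ∧ k + A *ᵥ w = u := by
  have hdisj : Disjoint (LinearMap.ker A.mulVecLin) (LinearMap.range A.mulVecLin) := by
    rw [Submodule.disjoint_def]
    rintro _ hx ⟨w, rfl⟩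
    exact hA w hx
  have hcompl := (Submodule.isCompl_iff_disjoint _ _ (by
    rw [add_comm, LinearMap.finrank_range_add_finrank_ker])).2 hdisj
  have hu : u ∈ LinearMap.ker A.mulVecLin ⊔ LinearMap.range A.mulVecLin := by
    rw [hcompl.sup_eq_top]
    trivial
  obtain ⟨k, hk, _, ⟨w, rfl⟩, h⟩ := Submodule.mem_sup.1 hu
  exact ⟨k, w, hk, h⟩

/-- If a block lower triangular matrix `M` satisfies `ker (M ^ 2) = ker M`, then the off-diagonal
block `C` sends the kernel of the first diagonal block into the range of the second one. -/
lemma exists_mulVec_eq_of_ker_sq_fromBlocks_eq {K m n : Type*} [Field K]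
    [Fintype m] [Fintype n] [DecidableEq m] [DecidableEq n]
    (P : Matrix m m K) (C : Matrix n m K) (A : Matrix n n K)
    (hker : LinearMap.ker ((fromBlocks P 0 C A) ^ 2).mulVecLin =
      LinearMap.ker (fromBlocks P 0 C A).mulVecLin)
    (v : m → K) (hv : P *ᵥ v = 0) : ∃ x, A *ᵥ x = C *ᵥ v := by
  have hmul : ∀ (v : m → K) (w : n → K), P *ᵥ v = 0 →
      fromBlocks P 0 C A *ᵥ Sum.elim v w = Sum.elim (0 : m → K) (C *ᵥ v + A *ᵥ w) := by
    intro v w hv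
    simp [fromBlocks_mulVec, hv]
  have key : ∀ (v : m → K) (w : n → K), P *ᵥ v = 0 →
      A *ᵥ (C *ᵥ v + A *ᵥ w) = 0 → C *ᵥ v + A *ᵥ w = 0 := by
    intro v w hv hw
    have hmem : Sum.elim v w ∈ LinearMap.ker ((fromBlocks P 0 C A) ^ 2).mulVecLin := by
      rw [LinearMap.mem_ker, mulVecLin_apply, sq, ← mulVec_mulVec, hmul v w hv,
        hmul 0 _ (mulVec_zero P), mulVec_zero, zero_add, hw, Sum.elim_zero_zero]
    rw [hker, LinearMap.mem_ker, mulVecLin_apply, hmul v w hv] at hmem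
    funext i
    exact congrFun hmem (Sum.inr i)
  obtain ⟨k, w, hk, hkw⟩ := exists_ker_add_range A
    (fun w hw => by simpa using key 0 w (mulVec_zero P) (by simpa using hw)) (C *ᵥ v)
  refine ⟨w, ?_⟩
  have hsub : C *ᵥ v + A *ᵥ (-w) = k := by
    rw [← hkw, mulVec_neg, add_neg_cancel_right]
  have hk0 : k = 0 := hsub ▸ key v (-w) hv (hsub ▸ hk)
  rw [← hkw, hk0, zero_add]

/-- For a feedforward coalescence network with Laplacian `L = [[L₁, 0], [C, B]]`,
`μ ≠ 0` and `u ∉ Im(B − μI)`: if `L₁` has an eigenvector associated with `μ` whose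
coalescence coordinate is nonzero, then `μ` is not a semisimple eigenvalue of `L`,
i.e. `ker((L − μI)²) ≠ ker(L − μI)`. -/
theorem statement13 (m₁ m₂ : ℕ) (hm₁ : 1 ≤ m₁) (hm₂ : 1 ≤ m₂)
    (L₁ : Matrix (Fin (m₁ + 1)) (Fin (m₁ + 1)) ℝ)
    (L₂ : Matrix (Fin (m₂ + 1)) (Fin (m₂ + 1)) ℝ)
    (hrow : ∀ j, L₂ 0 j = 0)
    (u : Fin m₂ → ℝ) (hu : ∀ i, u i = L₂ i.succ 0)
    (B : Matrix (Fin m₂) (Fin m₂) ℝ) (hB : ∀ i j, B i j = L₂ i.succ j.succ)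
    (C : Matrix (Fin m₂) (Fin (m₁ + 1)) ℝ)
    (hC : ∀ i j, C i j = if j = Fin.last m₁ then u i else 0)
    (L : Matrix (Fin (m₁ + 1) ⊕ Fin m₂) (Fin (m₁ + 1) ⊕ Fin m₂) ℝ)
    (hL : L = Matrix.fromBlocks L₁ 0 C B)
    (μ : ℝ) (hμ : μ ≠ 0)
    (hrange : ¬ ∃ x : Fin m₂ → ℝ,
      (B - μ • (1 : Matrix (Fin m₂) (Fin m₂) ℝ)).mulVec x = u)
    (v₁ : Fin m₁ → ℝ) (vc : ℝ) (hvc : vc ≠ 0)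
    (heig : L₁.mulVec (Fin.snoc v₁ vc) = μ • (Fin.snoc v₁ vc : Fin (m₁ + 1) → ℝ)) :
    LinearMap.ker (((L - μ • 1) ^ 2).mulVecLin) ≠
      LinearMap.ker ((L - μ • 1).mulVecLin) := by
  intro hker
  have hblocks : L - μ • 1 = fromBlocks (L₁ - μ • 1) 0 C (B - μ • 1) := by
    rw [hL, ← fromBlocks_one, fromBlocks_smul, sub_eq_add_neg, fromBlocks_neg, fromBlocks_add]
    simp [sub_eq_add_neg]
  rw [hblocks] at hker
  obtain ⟨x, hx⟩ := exists_mulVec_eq_of_ker_sq_fromBlocks_eq _ _ _ hker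
    (Fin.snoc v₁ vc : Fin (m₁ + 1) → ℝ)
    (by rw [sub_mulVec, smul_mulVec, one_mulVec, heig, sub_self])
  have hCv : C *ᵥ (Fin.snoc v₁ vc : Fin (m₁ + 1) → ℝ) = vc • u := by
    funext i
    simp [mulVec, dotProduct, hC, mul_comm]
  exact hrange ⟨vc⁻¹ • x, by rw [mulVec_smul, hx, hCv, inv_smul_smul₀ hvc]⟩
end

section
/- Let r ≥ 2 and n₁, …, n_r ≥ 2. Let A₁ be a real n₁ × n₁ matrix, and for each i = 2, …, r let A_i be a real n_i × n_i matrix whose first row is zero, with B_i the (n_i−1) × (n_i−1) matrix obtained from A_i by deleting its first row and first column. Let L be any block lower-triangular real matrix of size (n₁ + Σ_{i=2}^r (n_i − 1)) whose diagonal blocks are, in order, A₁, B₂, …, B_r. Then X^{r−1} · charpoly(L) = ∏_{i=1}^r charpoly(A_i). In particular, the eigenvalues of L are the union of the eigenvalues of A₁, …, A_r, the algebraic multiplicity of 0 for L equals Σ_{i=1}^r mⁱ_a(0) − r + 1, and for μ ≠ 0 the algebraic multiplicity of μ for L equals Σ_{i=1}^r mⁱ_a(μ), where mⁱ_a denotes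 algebraic multiplicity for A_i. -/
open Matrix Polynomial

namespace Matrix

variable {R : Type*} [CommRing R]

/-- A matrix with zero first row has characteristic polynomial `X` times that of the matrix
with its first row and column deleted. -/
lemma charpoly_eq_X_mul_of_row_zero {n : ℕ} (A : Matrix (Fin (n + 1)) (Fin (n + 1)) R)
    (h : ∀ j, A 0 j = 0) : A.charpoly = X * (A.submatrix Fin.succ Fin.succ).charpoly := by
  rw [charpoly, det_succ_row_zero, Fin.sum_univ_succ, Finset.sum_eq_zero]
  · have hsub : A.charmatrix.submatrix Fin.succ Fin.succ =
        (A.submatrix Fin.succ Fin.succ).charmatrix := by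
      ext1 i j
      simp [charmatrix_apply, diagonal_apply]
    simp [hsub, h, charpoly, charmatrix_apply_eq]
  · intro i _
    rw [charmatrix_apply_ne _ _ _ (Fin.succ_ne_zero i).symm, h]
    simp

/-- The characteristic polynomial of a block lower triangular matrix indexed by a sigma type. -/
lemma charpoly_sigma_of_lower {ι : Type*} [Fintype ι] [LinearOrder ι] {κ : ι → Type*}
    [∀ i, Fintype (κ i)] [∀ i, DecidableEq (κ i)]
    (D : Matrix (Σ i, κ i) (Σ i, κ i) R)
    (h : ∀ i j, i < j → ∀ a b, D ⟨i, a⟩ ⟨j, b⟩ = 0) :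
    D.charpoly = ∏ i, (D.submatrix (Sigma.mk i) (Sigma.mk i)).charpoly := by
  have hD : D.charmatrix.BlockTriangular fun p => OrderDual.toDual p.1 := by
    refine BlockTriangular.charmatrix ?_
    rintro ⟨i, a⟩ ⟨j, b⟩ hij
    exact h i j hij a b
  rw [charpoly, hD.det_fintype]
  refine Fintype.prod_equiv OrderDual.ofDual _ _ fun i => ?_
  let e : κ i.ofDual ≃ {p : Σ i, κ i // OrderDual.toDual p.1 = i} :=
    (Equiv.sigmaSubtype i.ofDual).symm
  rw [charpoly, ← det_submatrix_equiv_self e]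
  congr 1
  ext1 a b
  have he (c : κ i.ofDual) : (e c : Σ i, κ i) = ⟨i.ofDual, c⟩ := rfl
  simp [he, toSquareBlock, toSquareBlockProp, charmatrix_apply, diagonal_apply]

end Matrix

namespace Polynomial

lemma rootMultiplicity_finsetProd {R ι : Type*} [CommRing R] [IsDomain R] (s : Finset ι)
    (f : ι → R[X]) (hf : ∀ i ∈ s, f i ≠ 0) (a : R) :
    (∏ i ∈ s, f i).rootMultiplicity a = ∑ i ∈ s, (f i).rootMultiplicity a := by
  classical
  simp_rw [← count_roots]
  rw [roots_prod _ _ (Finset.prod_ne_zero_iff.2 hf), Multiset.count_bind]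
  rfl

end Polynomial

/-- For a feedforward coalescence network `N = N₁ ∘ N₂ ∘ ⋯ ∘ N_r` (here `r = s + 1`, with
first network `A₀` of size `m₀ + 1` and subsequent networks `A i` of size `m i + 1` whose
first row is zero), the Laplacian `L` is block lower triangular with diagonal blocks
`A₀, B₁, …, B_s` (each `B i` being `A i` with its first row and column deleted), and
`X^s · charpoly(L) = charpoly(A₀) · ∏ᵢ charpoly(A i)`; in particular the eigenvalues of
`L` are the union of those of the component networks, with
`m_a(0) + s = Σᵢ mⁱ_a(0)` and, for `μ ≠ 0`, `m_a(μ) = Σᵢ mⁱ_a(μ)`. -/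
theorem statement14 (s : ℕ) (hs : 1 ≤ s) (m₀ : ℕ) (hm₀ : 1 ≤ m₀)
    (m : Fin s → ℕ) (hm : ∀ i, 1 ≤ m i)
    (A₀ : Matrix (Fin (m₀ + 1)) (Fin (m₀ + 1)) ℝ)
    (A : ∀ i : Fin s, Matrix (Fin (m i + 1)) (Fin (m i + 1)) ℝ)
    (hrow : ∀ i j, A i 0 j = 0)
    (L : Matrix (Fin (m₀ + 1) ⊕ Σ i : Fin s, Fin (m i))
      (Fin (m₀ + 1) ⊕ Σ i : Fin s, Fin (m i)) ℝ)
    (htop : ∀ (a : Fin (m₀ + 1)) (p : Σ i : Fin s, Fin (m i)), L (Sum.inl a) (Sum.inr p) = 0)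
    (htri : ∀ (i j : Fin s), i < j → ∀ (a : Fin (m i)) (b : Fin (m j)),
      L (Sum.inr ⟨i, a⟩) (Sum.inr ⟨j, b⟩) = 0)
    (hdiag₀ : ∀ a b, L (Sum.inl a) (Sum.inl b) = A₀ a b)
    (hdiag : ∀ (i : Fin s) (a b : Fin (m i)),
      L (Sum.inr ⟨i, a⟩) (Sum.inr ⟨i, b⟩) = A i a.succ b.succ) :
    X ^ s * L.charpoly = A₀.charpoly * ∏ i, (A i).charpoly ∧
    ((L.charpoly.map (algebraMap ℝ ℂ)).rootMultiplicity 0 + s =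
        (A₀.charpoly.map (algebraMap ℝ ℂ)).rootMultiplicity 0 +
          ∑ i, ((A i).charpoly.map (algebraMap ℝ ℂ)).rootMultiplicity 0) ∧
    ∀ μ : ℂ, μ ≠ 0 →
      (L.charpoly.map (algebraMap ℝ ℂ)).rootMultiplicity μ =
        (A₀.charpoly.map (algebraMap ℝ ℂ)).rootMultiplicity μ +
          ∑ i, ((A i).charpoly.map (algebraMap ℝ ℂ)).rootMultiplicity μ := by
  have hL : L = fromBlocks A₀ 0 L.toBlocks₂₁ L.toBlocks₂₂ := by
    ext (a | a) (b | b) <;> simp [hdiag₀, htop, toBlocks₂₁, toBlocks₂₂]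
  have hblock (i : Fin s) : L.toBlocks₂₂.submatrix (Sigma.mk i) (Sigma.mk i) =
      (A i).submatrix Fin.succ Fin.succ := by
    ext a b
    simp [toBlocks₂₂, hdiag]
  have hchar : X ^ s * L.charpoly = A₀.charpoly * ∏ i, (A i).charpoly := by
    have hprod : L.charpoly =
        A₀.charpoly * ∏ i, ((A i).submatrix Fin.succ Fin.succ).charpoly := by
      rw [hL, charpoly_fromBlocks_zero₁₂, charpoly_sigma_of_lower _ htri]
      simp_rw [hblock]
    simp_rw [hprod, fun i => charpoly_eq_X_mul_of_row_zero (A i) (hrow i),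
      Finset.prod_mul_distrib, Finset.prod_const, Finset.card_univ, Fintype.card_fin]
    ring
  have hmult (μ : ℂ) : (X ^ s : ℂ[X]).rootMultiplicity μ +
      (L.charpoly.map (algebraMap ℝ ℂ)).rootMultiplicity μ =
        (A₀.charpoly.map (algebraMap ℝ ℂ)).rootMultiplicity μ +
          ∑ i, ((A i).charpoly.map (algebraMap ℝ ℂ)).rootMultiplicity μ := by
    have hA (i : Fin s) : (A i).charpoly.map (algebraMap ℝ ℂ) ≠ 0 :=
      ((A i).charpoly_monic.map _).ne_zero
    have hmap := congrArg (Polynomial.map (algebraMap ℝ ℂ)) hchar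
    simp only [Polynomial.map_mul, Polynomial.map_pow, map_X, Polynomial.map_prod] at hmap
    rw [← rootMultiplicity_finsetProd _ _ fun i _ => hA i,
      ← rootMultiplicity_mul, ← rootMultiplicity_mul, hmap]
    · exact mul_ne_zero (A₀.charpoly_monic.map _).ne_zero (Finset.prod_ne_zero_iff.2 fun i _ => hA i)
    · exact mul_ne_zero (pow_ne_zero _ X_ne_zero) (L.charpoly_monic.map _).ne_zero
  refine ⟨hchar, ?_, fun μ hμ => ?_⟩
  · have hX : (X ^ s : ℂ[X]).rootMultiplicity 0 = s := by
      simpa using rootMultiplicity_X_sub_C_pow (0 : ℂ) s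
    rw [← hmult 0, hX, add_comm]
  · have hX : (X ^ s : ℂ[X]).rootMultiplicity μ = 0 :=
      rootMultiplicity_eq_zero (by simp [hμ])
    rw [← hmult μ, hX, zero_add]
end

section
/- Let n ≥ 1, let W = (w_{ij}) be a real n × n matrix, let g : ℝ × ℝ → ℝ and h : ℝ × ℝ × ℝ → ℝ be functions, and let F : ℝⁿ × ℝ → ℝⁿ be the input-additive admissible system F_i(x, λ) = g(x_i, λ) + Σ_j w_{ij} h(x_i, x_j, λ). Write v(i) = Σ_j w_{ij} for the input valency of cell i. Then the following are equivalent: (a) for all z, λ ∈ ℝ and all cells i, j: F_i(z, …, z, λ) = F_j(z, …, z, λ) (the full-synchrony subspace is invariant); (b) for all z, λ ∈ ℝ and all cells i, j: h(z, z, λ)·(v(i) − v(j)) = 0; (c) either h(z, z, λ) = 0 for all z, λ (h is diffusive), or v(i) = v(j) for all i, j (the network is regular). -/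
open Matrix

/-- The full-synchrony subspace is invariant for the input-additive admissible system iff
`h(z,z,λ)(v(i) − v(j)) = 0` for all `z, λ, i, j`, iff the coupling is diffusive or the
network is regular. -/
theorem statement15 (n : ℕ) (hn : 1 ≤ n) (W : Matrix (Fin n) (Fin n) ℝ)
    (g : ℝ → ℝ → ℝ) (h : ℝ → ℝ → ℝ → ℝ)
    (v : Fin n → ℝ) (hv : ∀ i, v i = ∑ j, W i j) :
    ((∀ (z lam : ℝ) (i j : Fin n),
        admissF W g h (fun _ => z) lam i = admissF W g h (fun _ => z) lam j) ↔
      (∀ (z lam : ℝ) (i j : Fin n), h z z lam * (v i - v j) = 0)) ∧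
    ((∀ (z lam : ℝ) (i j : Fin n), h z z lam * (v i - v j) = 0) ↔
      ((∀ z lam : ℝ, h z z lam = 0) ∨ ∀ i j : Fin n, v i = v j)) := by
  have synchronous (z lam : ℝ) (i : Fin n) :
      admissF W g h (fun _ => z) lam i = g z lam + v i * h z z lam := by
    rw [admissF, hv, Finset.sum_mul]
  simp only [synchronous]
  refine ⟨?_, ?_, ?_⟩
  · refine forall₄_congr fun z lam i j => ?_
    constructor <;> intro H <;> linear_combination H
  · intro H
    by_contra! ⟨⟨z, lam, hz⟩, i, j, hij⟩
    exact mul_ne_zero hz (sub_ne_zero.mpr hij) (H z lam i j)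
  · rintro (H | H) z lam i j
    · rw [H, zero_mul]
    · rw [H i j, sub_self, mul_zero]
end

section
/- Let N = N₁ ∘ N₂ be a feedforward coalescence network: N₁ has cells {1, …, n₁} with adjacency W¹, N₂ has cells {c, 2, …, n₂} with adjacency W² satisfying w²_{cj} = 0 for all j ≠ c (the coalescence cell c, identified with cell n₁ of N₁, receives no edges from the other cells of N₂), and the adjacency of N is w^N_{cc} = w¹_{cc} + w²_{cc}, w^N_{ab} = w¹_{ab} for a, b ∈ N₁ with (a,b) ≠ (c,c), w^N_{ab} = w²_{ab} for a, b ∈ N₂ with (a,b) ≠ (c,c), and 0 otherwise. Let g, h be functions with h diffusive (h(z, z, λ) = 0 for all z, λ), and let F^N, F^{N₁}, F^{N₂} be the input-additive admissible systems of N, N₁, N₂ built from g and h. Then for all x₁ ∈ ℝ^{n₁−1}, x_c ∈ ℝ, x₂ ∈ ℝ^{n₂−1}, λ ∈ ℝ: F^N(x₁, x_c, x₂, λ) = 0 if and only if F^{N₁}(x₁, x_c, λ) = 0 and F^{N₂}_d(x_c, x₂, λ) = 0 for every cell d of N₂ with d ≠ c. -/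
open Matrix

/-- Under diffusive coupling, self-loops do not contribute, so adding a self-loop at `c` and
cells from which the old cells receive no edges leaves the dynamics of the old cells unchanged. -/
theorem admissF_inl_of_feedforward {ι κ : Type*} [Fintype ι] [DecidableEq ι] [Fintype κ]
    {W : Matrix ι ι ℝ} {V : Matrix (ι ⊕ κ) (ι ⊕ κ) ℝ} (c : ι) (w : ℝ)
    (hV : ∀ a b, V (Sum.inl a) (Sum.inl b) = if a = c ∧ b = c then W a b + w else W a b)
    (hV₀ : ∀ a j, V (Sum.inl a) (Sum.inr j) = 0)
    {g : ℝ → ℝ → ℝ} {h : ℝ → ℝ → ℝ → ℝ} (hdiff : ∀ z lam : ℝ, h z z lam = 0)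
    (x : ι → ℝ) (y : κ → ℝ) (lam : ℝ) (a : ι) :
    admissF V g h (Sum.elim x y) lam (Sum.inl a) = admissF W g h x lam a := by
  simp only [admissF, Fintype.sum_sum_type, Sum.elim_inl, Sum.elim_inr, hV, hV₀, zero_mul,
    Finset.sum_const_zero, add_zero]
  congr 1
  refine Finset.sum_congr rfl fun b _ => ?_
  split_ifs with hab
  · simp [hab.1, hab.2, hdiff]
  · rfl

/-- For a feedforward coalescence network `N = N₁ ∘ N₂` with diffusive coupling:
`F^N(x₁, x_c, x₂, λ) = 0` iff `F^{N₁}(x₁, x_c, λ) = 0` and `F^{N₂}_d(x_c, x₂, λ) = 0`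
for every cell `d ≠ c` of `N₂`.  The cells of `N₁` are `0, …, m₁` with coalescence cell
`c = m₁` (the last one), the cells of `N₂` are `0, …, m₂` with coalescence cell `0`,
and the state of `N` is written `Sum.elim (Fin.snoc x₁ x_c) x₂`. -/
theorem statement16 (m₁ m₂ : ℕ) (hm₁ : 1 ≤ m₁) (hm₂ : 1 ≤ m₂)
    (W₁ : Matrix (Fin (m₁ + 1)) (Fin (m₁ + 1)) ℝ)
    (W₂ : Matrix (Fin (m₂ + 1)) (Fin (m₂ + 1)) ℝ)
    (hffcn : ∀ j : Fin (m₂ + 1), j ≠ 0 → W₂ 0 j = 0)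
    (WN : Matrix (Fin (m₁ + 1) ⊕ Fin m₂) (Fin (m₁ + 1) ⊕ Fin m₂) ℝ)
    (hWN₁ : ∀ a b, WN (Sum.inl a) (Sum.inl b) =
      if a = Fin.last m₁ ∧ b = Fin.last m₁ then W₁ a b + W₂ 0 0 else W₁ a b)
    (hWN₂ : ∀ a j, WN (Sum.inl a) (Sum.inr j) =
      if a = Fin.last m₁ then W₂ 0 j.succ else 0)
    (hWN₃ : ∀ i b, WN (Sum.inr i) (Sum.inl b) =
      if b = Fin.last m₁ then W₂ i.succ 0 else 0)
    (hWN₄ : ∀ i j, WN (Sum.inr i) (Sum.inr j) = W₂ i.succ j.succ)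
    (g : ℝ → ℝ → ℝ) (h : ℝ → ℝ → ℝ → ℝ)
    (hdiff : ∀ z lam : ℝ, h z z lam = 0) :
    ∀ (x₁ : Fin m₁ → ℝ) (xc : ℝ) (x₂ : Fin m₂ → ℝ) (lam : ℝ),
      (∀ i, admissF WN g h (Sum.elim (Fin.snoc x₁ xc) x₂) lam i = 0) ↔
        ((∀ i, admissF W₁ g h (Fin.snoc x₁ xc) lam i = 0) ∧
          ∀ d : Fin m₂, admissF W₂ g h (Fin.cons xc x₂) lam d.succ = 0) := by
  intro x₁ xc x₂ lam
  have hl (a : Fin (m₁ + 1)) :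
      admissF WN g h (Sum.elim (Fin.snoc x₁ xc) x₂) lam (Sum.inl a) =
        admissF W₁ g h (Fin.snoc x₁ xc) lam a := by
    refine admissF_inl_of_feedforward (Fin.last m₁) (W₂ 0 0) (fun a b => hWN₁ a b)
      (fun a j => ?_) hdiff _ _ lam a
    rw [hWN₂, hffcn _ (Fin.succ_ne_zero j), ite_self]
  have hr (d : Fin m₂) :
      admissF WN g h (Sum.elim (Fin.snoc x₁ xc) x₂) lam (Sum.inr d) =
        admissF W₂ g h (Fin.cons xc x₂) lam d.succ := by
    simp [admissF, hWN₃, hWN₄, Fin.sum_univ_succ, ite_mul]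
  simp only [Sum.forall, hl, hr]
end

section
/- Let N = N₁ ∘ N₂ be a feedforward coalescence network (the coalescence cell c of N₂ receives no edges from the other cells of N₂, i.e., w²_{cj} = 0 for j ≠ c), let h be diffusive (h(z, z, λ) = 0 for all z, λ), and let F^N, F^{N₁}, F^{N₂} be the input-additive admissible systems of N, N₁, N₂ built from the same g, h. Let D ⊆ ℝ be an interval of the form (−ε, ε), [0, ε) or (−ε, 0] containing 0, and let (b₁, b_c) : D → ℝ^{n₁−1} × ℝ and (b_c', b₂) : D → ℝ × ℝ^{n₂−1} be equilibrium branches of F^{N₁} and F^{N₂} respectively (i.e., F^{N₁}(b₁(λ), b_c(λ), λ) = 0, F^{N₂}(b_c'(λ), b₂(λ), λ) = 0 for all λ ∈ D, and all branches vanish at λ = 0), with b_c ≡ b_c' on D. Then (b₁, b_c, b₂) : D → ℝ^{n₁+n₂−1} is an equilibrium branch of F^N, i.e., F^N(b₁(λ), b_c(λ), b₂(λ), λ) = 0 for all λ ∈ D. -/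
open Matrix

/-- For a feedforward coalescence network `N = N₁ ∘ N₂` with diffusive coupling,
equilibrium branches `(b₁, b_c)` of `F^{N₁}` and `(b_c', b₂)` of `F^{N₂}` defined on a
domain `D` of the form `(−ε, ε)`, `[0, ε)` or `(−ε, 0]` and agreeing on the coalescence
coordinate produce the equilibrium branch `(b₁, b_c, b₂)` of `F^N`. -/
theorem statement17 (m₁ m₂ : ℕ) (hm₁ : 1 ≤ m₁) (hm₂ : 1 ≤ m₂)
    (W₁ : Matrix (Fin (m₁ + 1)) (Fin (m₁ + 1)) ℝ)
    (W₂ : Matrix (Fin (m₂ + 1)) (Fin (m₂ + 1)) ℝ)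
    (hffcn : ∀ j : Fin (m₂ + 1), j ≠ 0 → W₂ 0 j = 0)
    (WN : Matrix (Fin (m₁ + 1) ⊕ Fin m₂) (Fin (m₁ + 1) ⊕ Fin m₂) ℝ)
    (hWN₁ : ∀ a b, WN (Sum.inl a) (Sum.inl b) =
      if a = Fin.last m₁ ∧ b = Fin.last m₁ then W₁ a b + W₂ 0 0 else W₁ a b)
    (hWN₂ : ∀ a j, WN (Sum.inl a) (Sum.inr j) =
      if a = Fin.last m₁ then W₂ 0 j.succ else 0)
    (hWN₃ : ∀ i b, WN (Sum.inr i) (Sum.inl b) =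
      if b = Fin.last m₁ then W₂ i.succ 0 else 0)
    (hWN₄ : ∀ i j, WN (Sum.inr i) (Sum.inr j) = W₂ i.succ j.succ)
    (g : ℝ → ℝ → ℝ) (h : ℝ → ℝ → ℝ → ℝ)
    (hdiff : ∀ z lam : ℝ, h z z lam = 0)
    (D : Set ℝ)
    (hD : ∃ ε : ℝ, 0 < ε ∧
      (D = Set.Ioo (-ε) ε ∨ D = Set.Ico 0 ε ∨ D = Set.Ioc (-ε) 0))
    (b₁ : ℝ → Fin m₁ → ℝ) (bc bc' : ℝ → ℝ) (b₂ : ℝ → Fin m₂ → ℝ)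
    (hb₁0 : b₁ 0 = 0) (hbc0 : bc 0 = 0) (hbc'0 : bc' 0 = 0) (hb₂0 : b₂ 0 = 0)
    (heq₁ : ∀ lam ∈ D, ∀ i,
      admissF W₁ g h (Fin.snoc (b₁ lam) (bc lam)) lam i = 0)
    (heq₂ : ∀ lam ∈ D, ∀ i,
      admissF W₂ g h (Fin.cons (bc' lam) (b₂ lam)) lam i = 0)
    (hagree : ∀ lam ∈ D, bc lam = bc' lam) :
    ∀ lam ∈ D, ∀ i,
      admissF WN g h (Sum.elim (Fin.snoc (b₁ lam) (bc lam)) (b₂ lam)) lam i = 0 := by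
  intro lam hlam i
  have hc := hagree lam hlam
  rcases i with a | i
  · have h1 := heq₁ lam hlam a
    simp only [admissF, Fintype.sum_sum_type, Sum.elim_inl, Sum.elim_inr, hWN₁, hWN₂] at h1 ⊢
    refine Eq.trans ?_ h1
    rw [add_right_inj]
    have hinr : ∑ j, (if a = Fin.last m₁ then W₂ 0 (Fin.succ j) else 0) *
        h (Fin.snoc (α := fun _ => ℝ) (b₁ lam) (bc lam) a) (b₂ lam j) lam = 0 :=
      Finset.sum_eq_zero fun j _ => by simp [hffcn j.succ (Fin.succ_ne_zero j)]
    rw [hinr, add_zero]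
    refine Finset.sum_congr rfl fun b _ => ?_
    split_ifs with hab
    · rw [hab.1, hab.2, hdiff, mul_zero, mul_zero]
    · rfl
  · have h2 := heq₂ lam hlam i.succ
    simp only [admissF, Fintype.sum_sum_type, Sum.elim_inl, Sum.elim_inr, hWN₃, hWN₄,
      Fin.sum_univ_succ (n := m₂), Fin.cons_zero, Fin.cons_succ, ite_mul, zero_mul,
      Finset.sum_ite_eq', Finset.mem_univ, if_true, Fin.snoc_last, hc] at h2 ⊢
    simpa using h2
end

section
/- Let N = N₁ ∘ N₂ be a feedforward coalescence network (the coalescence cell c of N₂ receives no edges from the other cells of N₂), let g, h be continuously differentiable with h diffusive (h(z, z, λ) = 0 for all z, λ) and g(0, 0) = 0, and let F^N and F^{N₁} be the input-additive admissible systems of N and N₁. Let δ > 0 and let b = (b₁, b_c) : (−δ, δ) → ℝ^{n₁−1} × ℝ be a continuous equilibrium branch of F^{N₁} (F^{N₁}(b(λ), λ) = 0, b(0) = 0). Define Φ : ℝ^{n₂−1} × (−δ, δ) → ℝ^{n₂−1} by Φ(x₂, λ) = (F^N_d(b₁(λ), b_c(λ), x₂, λ))_{d ∈ N₂, d ≠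 c}, and assume the Jacobian matrix ∂Φ/∂x₂(0, 0) is invertible. Then there exist ε ∈ (0, δ] and a unique continuous map b₂ : (−ε, ε) → ℝ^{n₂−1} with b₂(0) = 0 such that F^N(b₁(λ), b_c(λ), b₂(λ), λ) = 0 for all |λ| < ε; that is, the branch b of F^{N₁} extends to a unique equilibrium branch of F^N. -/
open Matrix

open Set Filter Topology

/-- The implicit function theorem along a continuous path of parameters: a nondegenerate zero
continues to a unique continuous branch of zeros. -/
theorem ContDiffAt.exists_unique_continuousOn_branch {E₁ E₂ G : Type*}
    [NormedAddCommGroup E₁] [NormedSpace ℝ E₁] [CompleteSpace E₁]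
    [NormedAddCommGroup E₂] [NormedSpace ℝ E₂] [CompleteSpace E₂]
    [NormedAddCommGroup G] [NormedSpace ℝ G] [CompleteSpace G]
    {f : E₁ × E₂ → G} {p : ℝ → E₁} {y : E₂} {δ : ℝ} (hδ : 0 < δ)
    (hp : ContinuousOn p (Ioo (-δ) δ)) (hf : ContDiffAt ℝ 1 f (p 0, y)) (hf0 : f (p 0, y) = 0)
    (hinv : (fderiv ℝ f (p 0, y) ∘L .inr ℝ E₁ E₂).IsInvertible) :
    ∃ ε : ℝ, 0 < ε ∧ ε ≤ δ ∧ ∃ b : ℝ → E₂, ContinuousOn b (Ioo (-ε) ε) ∧ b 0 = y ∧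
      (∀ t ∈ Ioo (-ε) ε, f (p t, b t) = 0) ∧
      ∀ b' : ℝ → E₂, ContinuousOn b' (Ioo (-ε) ε) → b' 0 = y →
        (∀ t ∈ Ioo (-ε) ε, f (p t, b' t) = 0) → ∀ t ∈ Ioo (-ε) ε, b' t = b t := by
  have h0 : (0 : ℝ) ∈ Ioo (-δ) δ := by simp [hδ]
  set φ := hf.implicitFunction one_ne_zero hinv
  have hφ0 : φ (p 0) = y := hf.implicitFunction_apply_self one_ne_zero hinv
  have hpc : ContinuousAt p 0 := hp.continuousAt (isOpen_Ioo.mem_nhds h0)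
  have hφC : ContDiffAt ℝ 1 φ (p 0) := hf.contDiffAt_implicitFunction one_ne_zero hinv
  have hzero : ∀ᶠ t in 𝓝 (0 : ℝ), f (p t, φ (p t)) = 0 := by
    simpa [hf0] using hpc.eventually (hf.eventually_apply_implicitFunction one_ne_zero hinv)
  have hcont : ∀ᶠ t in 𝓝 (0 : ℝ), ContinuousAt φ (p t) :=
    hpc.eventually ((hφC.eventually (by simp)).mono fun _ h => h.continuousAt)
  have hloc : ∀ᶠ t in 𝓝 (0 : ℝ), ∀ᶠ v in 𝓝 (p t, φ (p t)), f v = 0 → φ v.1 = v.2 := by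
    have hc : Tendsto (fun t => (p t, φ (p t))) (𝓝 0) (𝓝 (p 0, y)) := by
      have := hpc.prodMk (hφC.continuousAt.comp hpc)
      simpa [ContinuousAt, hφ0] using this
    refine hc.eventually (Filter.Eventually.eventually_nhds ?_)
    filter_upwards [hf.eventually_apply_eq_iff_implicitFunction one_ne_zero hinv] with v hv hv0
    exact hv.1 (hv0.trans hf0.symm)
  obtain ⟨r, hr, hball⟩ := Metric.eventually_nhds_iff_ball.1 (hzero.and (hcont.and hloc))
  rw [Real.ball_eq_Ioo, zero_sub, zero_add] at hball
  have hεr : Ioo (-min r δ) (min r δ) ⊆ Ioo (-r) r :=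
    Ioo_subset_Ioo (neg_le_neg (min_le_left _ _)) (min_le_left _ _)
  have hεδ : Ioo (-min r δ) (min r δ) ⊆ Ioo (-δ) δ :=
    Ioo_subset_Ioo (neg_le_neg (min_le_right _ _)) (min_le_right _ _)
  have hε : 0 < min r δ := lt_min hr hδ
  generalize min r δ = ε at hεr hεδ hε
  have hpε : ∀ t ∈ Ioo (-ε) ε, ContinuousAt p t := fun t ht =>
    hp.continuousAt (isOpen_Ioo.mem_nhds (hεδ ht))
  have hbε : ∀ t ∈ Ioo (-ε) ε, ContinuousAt (φ ∘ p) t := fun t ht =>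
    (hball t (hεr ht)).2.1.comp (hpε t ht)
  refine ⟨ε, hε, ?_, φ ∘ p, fun t ht => (hbε t ht).continuousWithinAt, hφ0,
    fun t ht => (hball t (hεr ht)).1, fun b' hb' hb'0 hfb' => ?_⟩
  · exact le_of_not_gt fun hlt => (hεδ ⟨by linarith, hlt⟩ : δ ∈ Ioo (-δ) δ).2.false
  have hb'ε : ∀ t ∈ Ioo (-ε) ε, ContinuousAt b' t := fun t ht =>
    hb'.continuousAt (isOpen_Ioo.mem_nhds ht)
  have hopen : ∀ t ∈ Ioo (-ε) ε, b' t = φ (p t) → ∀ᶠ s in 𝓝 t, b' s = φ (p s) := by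
    intro t ht hbt
    have hc : Tendsto (fun s => (p s, b' s)) (𝓝 t) (𝓝 (p t, φ (p t))) := by
      have := (hpε t ht).prodMk (hb'ε t ht)
      simpa [ContinuousAt, hbt] using this
    filter_upwards [hc.eventually (hball t (hεr ht)).2.2, isOpen_Ioo.mem_nhds ht] with s hs hsε
    exact (hs (hfb' s hsε)).symm
  have hsub : Ioo (-ε) ε ⊆ {t | ∀ᶠ s in 𝓝 t, b' s = φ (p s)} := by
    refine isPreconnected_Ioo.subset_left_of_subset_union isOpen_setOfPred_eventually_nhds
      (isOpen_setOfPred_eventually_nhds (p := fun s => b' s ≠ φ (p s))) ?_ ?_ ?_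
    · exact Set.disjoint_left.2 fun t ht ht' => ht'.self_of_nhds ht.self_of_nhds
    · intro t ht
      by_cases hbt : b' t = φ (p t)
      · exact Or.inl (hopen t ht hbt)
      · exact Or.inr ((hb'ε t ht).ne_iff_eventually_ne (hbε t ht) |>.1 hbt)
    · have h0ε : (0 : ℝ) ∈ Ioo (-ε) ε := by simp [hε]
      exact ⟨0, h0ε, hopen 0 h0ε (hb'0.trans hφ0.symm)⟩
  exact fun t ht => (hsub ht).self_of_nhds

/-- A continuous linear endomorphism of a coordinate space is invertible as soon as its matrix
is. -/
theorem ContinuousLinearMap.isInvertible_of_isUnit_matrix {n : ℕ}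
    {L : (Fin n → ℝ) →L[ℝ] (Fin n → ℝ)}
    (hL : IsUnit (Matrix.of fun d j => L (Pi.single j 1) d)) : L.IsInvertible := by
  have hM : L.toLinearMap = Matrix.toLin' (Matrix.of fun d j => L (Pi.single j 1) d) := by
    refine (Matrix.toLin'_toMatrix' L.toLinearMap).symm.trans ?_
    ext d j
    simp
  have hunit : IsUnit L.toLinearMap := by
    rw [hM]
    exact hL.map Matrix.toLinAlgEquiv'
  have hbij := (Module.End.isUnit_iff _).1 hunit
  exact ⟨(LinearEquiv.ofBijective L.toLinearMap hbij).toContinuousLinearEquiv, by ext; rfl⟩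

/-- The equations of the downstream cells of a feedforward coalescence network, as a function of
the state `y` of the coalescence cell, the parameter, and the states of the downstream cells. -/
def downstreamF {m : ℕ} (W : Matrix (Fin (m + 1)) (Fin (m + 1)) ℝ) (g : ℝ → ℝ → ℝ)
    (h : ℝ → ℝ → ℝ → ℝ) (v : (ℝ × ℝ) × (Fin m → ℝ)) : Fin m → ℝ := fun i =>
  g (v.2 i) v.1.2 + (W i.succ 0 * h (v.2 i) v.1.1 v.1.2 +
    ∑ j : Fin m, W i.succ j.succ * h (v.2 i) (v.2 j) v.1.2)

theorem contDiff_downstreamF {m : ℕ} (W : Matrix (Fin (m + 1)) (Fin (m + 1)) ℝ)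
    {g : ℝ → ℝ → ℝ} {h : ℝ → ℝ → ℝ → ℝ}
    (hg : ContDiff ℝ 1 (fun p : ℝ × ℝ => g p.1 p.2))
    (hh : ContDiff ℝ 1 (fun p : ℝ × ℝ × ℝ => h p.1 p.2.1 p.2.2)) :
    ContDiff ℝ 1 (downstreamF W g h) := by
  have hx (i : Fin m) : ContDiff ℝ 1 fun v : (ℝ × ℝ) × (Fin m → ℝ) => v.2 i :=
    (contDiff_apply ℝ ℝ i).comp contDiff_snd
  have hy : ContDiff ℝ 1 fun v : (ℝ × ℝ) × (Fin m → ℝ) => v.1.1 := contDiff_fst.fst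
  have hl : ContDiff ℝ 1 fun v : (ℝ × ℝ) × (Fin m → ℝ) => v.1.2 := contDiff_fst.snd
  refine contDiff_pi.2 fun i => ?_
  exact (hg.comp ((hx i).prodMk hl)).add
    ((contDiff_const.mul (hh.comp ((hx i).prodMk (hy.prodMk hl)))).add
      (ContDiff.sum fun j _ => contDiff_const.mul (hh.comp ((hx i).prodMk ((hx j).prodMk hl)))))

theorem downstreamF_zero {m : ℕ} (W : Matrix (Fin (m + 1)) (Fin (m + 1)) ℝ)
    {g : ℝ → ℝ → ℝ} {h : ℝ → ℝ → ℝ → ℝ} (hdiff : ∀ z lam : ℝ, h z z lam = 0)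
    (hg0 : g 0 0 = 0) : downstreamF W g h ((0, 0), 0) = 0 := by
  ext i
  simp [downstreamF, hdiff, hg0]

/-- For a feedforward coalescence network `N = N₁ ∘ N₂` with diffusive `C¹` dynamics and
`g(0,0) = 0`: if `b = (b₁, b_c)` is a continuous equilibrium branch of `F^{N₁}` on
`(−δ, δ)` and the Jacobian `∂Φ/∂x₂(0,0)` of `Φ(x₂, λ) = (F^N_d(b₁(λ), b_c(λ), x₂, λ))_{d ∈ N₂, d ≠ c}`
is invertible, then `b` extends to a unique continuous equilibrium branch of `F^N` on
some interval `(−ε, ε)` with `0 < ε ≤ δ`. -/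
theorem statement18 (m₁ m₂ : ℕ) (hm₁ : 1 ≤ m₁) (hm₂ : 1 ≤ m₂)
    (W₁ : Matrix (Fin (m₁ + 1)) (Fin (m₁ + 1)) ℝ)
    (W₂ : Matrix (Fin (m₂ + 1)) (Fin (m₂ + 1)) ℝ)
    (hffcn : ∀ j : Fin (m₂ + 1), j ≠ 0 → W₂ 0 j = 0)
    (WN : Matrix (Fin (m₁ + 1) ⊕ Fin m₂) (Fin (m₁ + 1) ⊕ Fin m₂) ℝ)
    (hWN₁ : ∀ a b, WN (Sum.inl a) (Sum.inl b) =
      if a = Fin.last m₁ ∧ b = Fin.last m₁ then W₁ a b + W₂ 0 0 else W₁ a b)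
    (hWN₂ : ∀ a j, WN (Sum.inl a) (Sum.inr j) =
      if a = Fin.last m₁ then W₂ 0 j.succ else 0)
    (hWN₃ : ∀ i b, WN (Sum.inr i) (Sum.inl b) =
      if b = Fin.last m₁ then W₂ i.succ 0 else 0)
    (hWN₄ : ∀ i j, WN (Sum.inr i) (Sum.inr j) = W₂ i.succ j.succ)
    (g : ℝ → ℝ → ℝ) (h : ℝ → ℝ → ℝ → ℝ)
    (hg : ContDiff ℝ 1 (fun p : ℝ × ℝ => g p.1 p.2))
    (hh : ContDiff ℝ 1 (fun p : ℝ × ℝ × ℝ => h p.1 p.2.1 p.2.2))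
    (hdiff : ∀ z lam : ℝ, h z z lam = 0)
    (hg0 : g 0 0 = 0)
    (δ : ℝ) (hδ : 0 < δ)
    (b₁ : ℝ → Fin m₁ → ℝ) (bc : ℝ → ℝ)
    (hb₁cont : ContinuousOn b₁ (Set.Ioo (-δ) δ))
    (hbccont : ContinuousOn bc (Set.Ioo (-δ) δ))
    (hb₁0 : b₁ 0 = 0) (hbc0 : bc 0 = 0)
    (hbranch : ∀ lam ∈ Set.Ioo (-δ) δ, ∀ i,
      admissF W₁ g h (Fin.snoc (b₁ lam) (bc lam)) lam i = 0)
    (Φ : (Fin m₂ → ℝ) → ℝ → Fin m₂ → ℝ)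
    (hΦ : ∀ x₂ lam d, Φ x₂ lam d =
      admissF WN g h (Sum.elim (Fin.snoc (b₁ lam) (bc lam)) x₂) lam (Sum.inr d))
    (hJ : IsUnit (Matrix.of fun d j : Fin m₂ =>
      fderiv ℝ (fun x₂ => Φ x₂ 0 d) 0 (Pi.single j 1))) :
    ∃ ε : ℝ, 0 < ε ∧ ε ≤ δ ∧
      ∃ b₂ : ℝ → Fin m₂ → ℝ,
        ContinuousOn b₂ (Set.Ioo (-ε) ε) ∧ b₂ 0 = 0 ∧
        (∀ lam ∈ Set.Ioo (-ε) ε, ∀ i,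
          admissF WN g h (Sum.elim (Fin.snoc (b₁ lam) (bc lam)) (b₂ lam)) lam i = 0) ∧
        ∀ b₂' : ℝ → Fin m₂ → ℝ,
          ContinuousOn b₂' (Set.Ioo (-ε) ε) → b₂' 0 = 0 →
          (∀ lam ∈ Set.Ioo (-ε) ε, ∀ i,
            admissF WN g h (Sum.elim (Fin.snoc (b₁ lam) (bc lam)) (b₂' lam)) lam i = 0) →
          ∀ lam ∈ Set.Ioo (-ε) ε, b₂' lam = b₂ lam := by
  have hinr : ∀ x₂ lam d,
      admissF WN g h (Sum.elim (Fin.snoc (b₁ lam) (bc lam)) x₂) lam (Sum.inr d) =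
        downstreamF W₂ g h ((bc lam, lam), x₂) d := by
    intro x₂ lam d
    simp [admissF, downstreamF, Fintype.sum_sum_type, hWN₃, hWN₄]
  have hinl : ∀ x₂ lam a,
      admissF WN g h (Sum.elim (Fin.snoc (b₁ lam) (bc lam)) x₂) lam (Sum.inl a) =
        admissF W₁ g h (Fin.snoc (b₁ lam) (bc lam)) lam a := by
    intro x₂ lam a
    have hW₂ : ∀ j : Fin m₂, W₂ 0 j.succ = 0 := fun j => hffcn _ j.succ_ne_zero
    simp only [admissF, Fintype.sum_sum_type, Sum.elim_inl, Sum.elim_inr, hWN₁, hWN₂, hW₂,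
      ite_self, zero_mul, Finset.sum_const_zero, add_zero]
    congr 1
    refine Finset.sum_congr rfl fun b _ => ?_
    split_ifs with hab
    · rw [hab.1, hab.2, hdiff, mul_zero, mul_zero]
    · rfl
  have hiff : ∀ x₂, ∀ lam ∈ Ioo (-δ) δ,
      (∀ i, admissF WN g h (Sum.elim (Fin.snoc (b₁ lam) (bc lam)) x₂) lam i = 0) ↔
        downstreamF W₂ g h ((bc lam, lam), x₂) = 0 := by
    intro x₂ lam hlam
    simp only [Sum.forall, hinl, hinr, hbranch lam hlam, implies_true, true_and, funext_iff,
      Pi.zero_apply]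
  have hC := contDiff_downstreamF W₂ hg hh
  have hinv : (fderiv ℝ (downstreamF W₂ g h) ((bc 0, 0), 0) ∘L
      .inr ℝ (ℝ × ℝ) (Fin m₂ → ℝ)).IsInvertible := by
    refine ContinuousLinearMap.isInvertible_of_isUnit_matrix ?_
    convert! hJ using 3
    rename_i d
    ext j
    have hfd : HasFDerivAt (fun x₂ : Fin m₂ → ℝ => downstreamF W₂ g h ((bc 0, 0), x₂))
        (fderiv ℝ (downstreamF W₂ g h) ((bc 0, 0), 0) ∘L .inr ℝ (ℝ × ℝ) (Fin m₂ → ℝ)) 0 :=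
      ((hC.differentiable one_ne_zero _).hasFDerivAt).comp (0 : Fin m₂ → ℝ)
        (hasFDerivAt_prodMk_right (bc 0, (0 : ℝ)) (0 : Fin m₂ → ℝ))
    have hΦd : (fun x₂ => Φ x₂ 0 d) = fun x₂ => downstreamF W₂ g h ((bc 0, 0), x₂) d :=
      funext fun x₂ => (hΦ x₂ 0 d).trans (hinr x₂ 0 d)
    rw [hΦd, (hasFDerivAt_pi'.1 hfd d).fderiv]
    rfl
  obtain ⟨ε, hε, hεδ, b₂, hb₂, hb₂0, hzero, huniq⟩ :=
    ContDiffAt.exists_unique_continuousOn_branch (p := fun t => (bc t, t)) hδ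
      (hbccont.prodMk continuousOn_id) hC.contDiffAt
      (by simpa [hbc0] using downstreamF_zero W₂ hdiff hg0) hinv
  have hsub : Ioo (-ε) ε ⊆ Ioo (-δ) δ := Ioo_subset_Ioo (neg_le_neg hεδ) hεδ
  exact ⟨ε, hε, hεδ, b₂, hb₂, hb₂0,
    fun lam hlam => (hiff _ lam (hsub hlam)).2 (hzero lam hlam),
    fun b₂' hb₂' hb₂'0 hF => huniq b₂' hb₂' hb₂'0 fun lam hlam =>
      (hiff _ lam (hsub hlam)).1 (hF lam hlam)⟩
end
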